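/- arXiv:2002.03077 — 2 statements merged into one kernel-verified Lean document; each statement's English description precedes it below -/
import Mathlib

section
/- Let 𝓡 = (R, <, +, 0, …) be an expansion of a densely linearly ordered abelian group with 𝓡 ⊨ DC and 𝓡 ⊨ LUF₂. For any definable set X ⊆ R^{m+1} and any point (b,a) ∈ R^m × R, there exist positive integers N₁ and N₂, an open interval I containing a, and an open box U containing b, such that for every x ∈ U: (i) the open set int(X_x) ∩ I is the union of at most N₁ open intervals in I; and (ii) the closed set cl(X_x) ∩ cl(I) is the union of at most N₁ points and N₂ closed intervals in cl(I). In addition, U can be taken to be R^m if 𝓡 ⊨ LUF₁, and I can be taken independently of X if 𝓡 ⊨ SLUF. -/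
open FirstOrder Set Topology

section CommonDefs

/-- A subset of `R^n` (coded as `Fin n → R`) is definable in the structure `𝓡` (with
universe `R` and language `L`) with parameters. -/
def IsDefinable (L : FirstOrder.Language) {R : Type*} [L.Structure R] {n : ℕ}
    (X : Set (Fin n → R)) : Prop :=
  Set.Definable (Set.univ : Set R) L X

/-- An open box in `R^n`: a product of `n` open intervals. -/
def OpenBox {R : Type*} [LT R] {n : ℕ} (B : Set (Fin n → R)) : Prop :=
  ∃ c d : Fin n → R, B = {x | ∀ i, c i < x i ∧ x i < d i}

/-- A closed box in `R^n`: a product of `n` closed intervals. -/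
def ClosedBox {R : Type*} [LE R] {n : ℕ} (B : Set (Fin n → R)) : Prop :=
  ∃ c d : Fin n → R, B = {x | ∀ i, c i ≤ x i ∧ x i ≤ d i}

/-- A subset of `R` which is a finite union of points and open intervals. -/
def FinUnionPtsIntervals {R : Type*} [Preorder R] (s : Set R) : Prop :=
  ∃ (P : Finset R) (Q : Finset (R × R)), s = ↑P ∪ ⋃ p ∈ Q, Set.Ioo p.1 p.2

/-- The fiber `X_x ⊆ R` of a set `X ⊆ R^{m+1}` over `x ∈ R^m`. -/
def fiber1 {R : Type*} {m : ℕ} (X : Set (Fin (m + 1) → R)) (x : Fin m → R) : Set R :=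
  {y | Fin.snoc x y ∈ X}

/-- The fiber `X_x ⊆ R^n` of a set `X ⊆ R^{m+n}` over `x ∈ R^m`. -/
def fiberN {R : Type*} {m n : ℕ} (X : Set (Fin (m + n) → R)) (x : Fin m → R) :
    Set (Fin n → R) :=
  {y | Fin.append x y ∈ X}

/-- The member `X_{r,s} ⊆ R^n` of a parameterized family coded by `F ⊆ R^{2+n}`. -/
def famFiber {R : Type*} {n : ℕ} (F : Set (Fin (2 + n) → R)) (r s : R) : Set (Fin n → R) :=
  {y | Fin.append ![r, s] y ∈ F}

/-- A bounded subset of `R^n`: contained in some closed box. -/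
def BddSet {R : Type*} [LE R] {n : ℕ} (X : Set (Fin n → R)) : Prop :=
  ∃ c d : R, ∀ y ∈ X, ∀ i, c ≤ y i ∧ y i ≤ d

/-- A discrete subset of a topological space: each of its points is isolated. -/
def DiscreteSet {α : Type*} [TopologicalSpace α] (S : Set α) : Prop :=
  ∀ y ∈ S, ∃ U : Set α, IsOpen U ∧ y ∈ U ∧ U ∩ S = {y}

/-- A locally finite subset: each point of the space has an open neighborhood meeting
the set in a finite set. -/
def LocFin {α : Type*} [TopologicalSpace α] (S : Set α) : Prop :=
  ∀ x : α, ∃ U : Set α, IsOpen U ∧ x ∈ U ∧ (S ∩ U).Finite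

/-- `F ⊆ R^{2+n}` codes a `D_Σ`-family `{X_{r,s}}_{r>0,s>0}` of CBD subsets of `R^n`:
each fiber is closed, bounded and definable, the family is increasing in `r` and
decreasing in `s`. -/
def IsDSigmaFamily (L : FirstOrder.Language) {R : Type*} [L.Structure R] [LinearOrder R]
    [Zero R] [TopologicalSpace R] {n : ℕ} (F : Set (Fin (2 + n) → R)) : Prop :=
  IsDefinable L F ∧
    (∀ r s : R, 0 < r → 0 < s →
      IsDefinable L (famFiber F r s) ∧ IsClosed (famFiber F r s) ∧ BddSet (famFiber F r s)) ∧
    (∀ r r' s : R, 0 < r → 0 < s → r ≤ r' → famFiber F r s ⊆ famFiber F r' s) ∧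
    (∀ r s s' : R, 0 < r → 0 < s → s ≤ s' → famFiber F r s' ⊆ famFiber F r s)

/-- A `D_Σ`-set: the union `⋃_{r>0,s>0} X_{r,s}` of a `D_Σ`-family. -/
def IsDSigma (L : FirstOrder.Language) {R : Type*} [L.Structure R] [LinearOrder R]
    [Zero R] [TopologicalSpace R] {n : ℕ} (X : Set (Fin n → R)) : Prop :=
  ∃ F : Set (Fin (2 + n) → R), IsDSigmaFamily L F ∧
    X = ⋃ (r : R) (_ : 0 < r) (s : R) (_ : 0 < s), famFiber F r s

/-- Constructible sets: finite boolean combinations of open sets. -/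
inductive IsConstructibleSet {α : Type*} [TopologicalSpace α] : Set α → Prop
  | of_isOpen (s : Set α) : IsOpen s → IsConstructibleSet s
  | compl (s : Set α) : IsConstructibleSet s → IsConstructibleSet sᶜ
  | union (s t : Set α) : IsConstructibleSet s → IsConstructibleSet t →
      IsConstructibleSet (s ∪ t)

/-- `𝓡 ⊨ DC`: every nonempty definable subset of `R` bounded above has a supremum. -/
def DCProp (L : FirstOrder.Language) (R : Type*) [L.Structure R] [Preorder R] : Prop :=
  ∀ s : Set R, IsDefinable L {v : Fin 1 → R | v 0 ∈ s} → s.Nonempty → BddAbove s →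
    ∃ a : R, IsLUB s a

/-- `𝓡 ⊨ LUF₂` (locally uniform finiteness of the second kind). -/
def LUF2 (L : FirstOrder.Language) (R : Type*) [L.Structure R] [LinearOrder R]
    [TopologicalSpace R] : Prop :=
  ∀ (m : ℕ) (X : Set (Fin (m + 1) → R)), IsDefinable L X → ∀ (a : R) (b : Fin m → R),
    ∃ N : ℕ, 0 < N ∧ ∃ p q : R, a ∈ interior (Set.Icc p q) ∧
      ∃ U : Set (Fin m → R), OpenBox U ∧ b ∈ U ∧
        ∀ x ∈ U, ∀ p' q' : R, a ∈ interior (Set.Icc p' q') → Set.Icc p' q' ⊆ Set.Icc p q →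
          (fiber1 X x ∩ Set.Icc p' q').Infinite ∨ (fiber1 X x ∩ Set.Icc p' q').ncard ≤ N

/-- `𝓡 ⊨ LUF₁`: `LUF₂` with `U` always taken to be all of `R^m`. -/
def LUF1 (L : FirstOrder.Language) (R : Type*) [L.Structure R] [LinearOrder R]
    [TopologicalSpace R] : Prop :=
  ∀ (m : ℕ) (X : Set (Fin (m + 1) → R)), IsDefinable L X → ∀ a : R,
    ∃ N : ℕ, 0 < N ∧ ∃ p q : R, a ∈ interior (Set.Icc p q) ∧
      ∀ (x : Fin m → R), ∀ p' q' : R,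
        a ∈ interior (Set.Icc p' q') → Set.Icc p' q' ⊆ Set.Icc p q →
          (fiber1 X x ∩ Set.Icc p' q').Infinite ∨ (fiber1 X x ∩ Set.Icc p' q').ncard ≤ N

/-- `𝓡 ⊨ SLUF`: `LUF₁` with the interval `I` chosen independently of the definable set. -/
def SLUF (L : FirstOrder.Language) (R : Type*) [L.Structure R] [LinearOrder R]
    [TopologicalSpace R] : Prop :=
  ∀ a : R, ∃ p q : R, a ∈ interior (Set.Icc p q) ∧
    ∀ (m : ℕ) (X : Set (Fin (m + 1) → R)), IsDefinable L X →
      ∃ N : ℕ, 0 < N ∧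
        ∀ (x : Fin m → R), ∀ p' q' : R,
          a ∈ interior (Set.Icc p' q') → Set.Icc p' q' ⊆ Set.Icc p q →
            (fiber1 X x ∩ Set.Icc p' q').Infinite ∨ (fiber1 X x ∩ Set.Icc p' q').ncard ≤ N

/-- The language of the open core of `𝓡`: one `n`-ary relation symbol for each
`𝓡`-definable open subset of `R^n`. -/
def openCoreLang (L : FirstOrder.Language) (R : Type*) [L.Structure R] [TopologicalSpace R] :
    FirstOrder.Language where
  Functions := fun _ => Empty
  Relations := fun n => { s : Set (Fin n → R) // Set.Definable (Set.univ : Set R) L s ∧ IsOpen s }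

/-- The open core of `𝓡`: the structure on `R` interpreting each relation symbol by the
corresponding `𝓡`-definable open set. -/
def openCoreStructure (L : FirstOrder.Language) (R : Type*) [L.Structure R]
    [TopologicalSpace R] : (openCoreLang L R).Structure R where
  funMap := fun f _ => f.elim
  RelMap := fun s x => x ∈ s.1

/-- A set is definable in the open core of `𝓡` if it is definable (with parameters) in the
structure generated by the `𝓡`-definable open sets. -/
def DefinableInOpenCore (L : FirstOrder.Language) (R : Type*) [L.Structure R]
    [TopologicalSpace R] {n : ℕ} (X : Set (Fin n → R)) : Prop :=
  letI := openCoreStructure L R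
  Set.Definable (Set.univ : Set R) (openCoreLang L R) X

/-- The local dimension `dim_x X` of `X ⊆ R^n` at `x`, an element of `{-∞} ∪ ℕ ∪ {∞}`:
the supremum of the nonnegative integers `d` such that for every open box `B` containing
`x`, some coordinate projection of `B ∩ X` to `R^d` has nonempty interior (and `-∞` if
some open box containing `x` misses `X`). -/
noncomputable def locDim {R : Type*} [LT R] [TopologicalSpace R] {n : ℕ}
    (X : Set (Fin n → R)) (x : Fin n → R) : WithBot ℕ∞ :=
  sSup {e : WithBot ℕ∞ | ∃ d : ℕ, e = ((d : ℕ∞) : WithBot ℕ∞) ∧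
    ∀ B : Set (Fin n → R), OpenBox B → x ∈ B →
      ∃ f : Fin d → Fin n, Function.Injective f ∧
        (interior ((fun y => y ∘ f) '' (B ∩ X))).Nonempty}

/-- The dimension of `X ⊆ R^n`: the supremum of the local dimensions. -/
noncomputable def setDim {R : Type*} [LT R] [TopologicalSpace R] {n : ℕ}
    (X : Set (Fin n → R)) : WithBot ℕ∞ :=
  ⨆ x : Fin n → R, locDim X x

/-- The projective dimension of `X ⊆ R^n`: the supremum of the nonnegative integers `d`
such that some coordinate projection of `X` to `R^d` has nonempty interior (`-∞` for the
empty set). -/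
noncomputable def projDim {R : Type*} [TopologicalSpace R] {n : ℕ}
    (X : Set (Fin n → R)) : WithBot ℕ∞ :=
  sSup {e : WithBot ℕ∞ | ∃ d : ℕ, e = ((d : ℕ∞) : WithBot ℕ∞) ∧
    ∃ f : Fin d → Fin n, Function.Injective f ∧
      (interior ((fun y => y ∘ f) '' X)).Nonempty}

/-- A subset of `R` which is a union of at most `N` open intervals. -/
def UnionAtMostOpenIntervals {R : Type*} [Preorder R] (N : ℕ) (s : Set R) : Prop :=
  ∃ Q : Finset (R × R), Q.card ≤ N ∧ s = ⋃ p ∈ Q, Set.Ioo p.1 p.2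

/-- A subset of `R` which is a union of at most `N₁` points and `N₂` closed intervals. -/
def UnionAtMostPtsClosedIntervals {R : Type*} [Preorder R] (N₁ N₂ : ℕ) (s : Set R) : Prop :=
  ∃ (P : Finset R) (Q : Finset (R × R)), P.card ≤ N₁ ∧ Q.card ≤ N₂ ∧
    s = ↑P ∪ ⋃ p ∈ Q, Set.Icc p.1 p.2

/-- A subset of `R` which is a union of at most `N₁` points and `N₂` open intervals. -/
def UnionAtMostPtsOpenIntervals {R : Type*} [Preorder R] (N₁ N₂ : ℕ) (s : Set R) : Prop :=
  ∃ (P : Finset R) (Q : Finset (R × R)), P.card ≤ N₁ ∧ Q.card ≤ N₂ ∧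
    s = ↑P ∪ ⋃ p ∈ Q, Set.Ioo p.1 p.2

/-- `X ∩ B` is the graph of a continuous map defined on the coordinate-projection image
of `B` (the projection being given by the injection `f` of coordinates). -/
def IsGraphOn {R : Type*} [TopologicalSpace R] {n d : ℕ} (f : Fin d → Fin n)
    (S : Set (Fin n → R)) (D : Set (Fin d → R)) : Prop :=
  ∃ g : (Fin d → R) → (Fin n → R), ContinuousOn g D ∧ (∀ z ∈ D, (g z) ∘ f = z) ∧ S = g '' D

end CommonDefs

set_option linter.unusedSectionVars false

section DefTools

variable {L : FirstOrder.Language} {R : Type*} [L.Structure R]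

/-- Definability (with parameters) of a predicate on tuples. -/
def Dfp (L : FirstOrder.Language) {R : Type*} [L.Structure R] {α : Type*}
    (P : (α → R) → Prop) : Prop :=
  Set.Definable (Set.univ : Set R) L {v | P v}

/-- A function given by a term. -/
def Tmf (L : FirstOrder.Language) {R : Type*} [L.Structure R] {α : Type*}
    (t : (α → R) → R) : Prop :=
  ∃ τ : L[[(Set.univ : Set R)]].Term α, ∀ v, τ.realize v = t v

theorem tmf_var {α : Type*} (i : α) : Tmf L (fun v : α → R => v i) :=
  ⟨FirstOrder.Language.Term.var i, fun _ => rfl⟩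

theorem tmf_const {α : Type*} (c : R) : Tmf L (fun _ : α → R => c) :=
  ⟨(L.con (⟨c, Set.mem_univ c⟩ : (Set.univ : Set R))).term, fun v => by
    rw [FirstOrder.Language.Term.realize_con]⟩

theorem dfp_atom {α β : Type*} {S : Set (β → R)}
    (hS : Set.Definable (Set.univ : Set R) L S) (t : β → (α → R) → R)
    (ht : ∀ k, Tmf L (t k)) : Dfp L (fun v : α → R => (fun k => t k v) ∈ S) := by
  obtain ⟨φ, rfl⟩ := hS
  choose τ hτ using ht
  refine ⟨FirstOrder.Language.BoundedFormula.subst φ τ, ?_⟩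
  ext v
  simp only [Set.mem_ofPred_eq, FirstOrder.Language.Formula.Realize,
    FirstOrder.Language.BoundedFormula.realize_subst, hτ]

theorem dfp_and {α : Type*} {P Q : (α → R) → Prop} (hP : Dfp L P) (hQ : Dfp L Q) :
    Dfp L (fun v => P v ∧ Q v) := Set.Definable.inter hP hQ

theorem dfp_or {α : Type*} {P Q : (α → R) → Prop} (hP : Dfp L P) (hQ : Dfp L Q) :
    Dfp L (fun v => P v ∨ Q v) := Set.Definable.union hP hQ

theorem dfp_not {α : Type*} {P : (α → R) → Prop} (hP : Dfp L P) :
    Dfp L (fun v => ¬ P v) := Set.Definable.compl hP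

theorem dfp_imp {α : Type*} {P Q : (α → R) → Prop} (hP : Dfp L P) (hQ : Dfp L Q) :
    Dfp L (fun v => P v → Q v) := by
  have := dfp_or (dfp_not hP) hQ
  simpa only [imp_iff_not_or] using this

theorem dfp_ex {α : Type*} [Finite α] {P : (α → R) → R → Prop}
    (h : Dfp L (fun w : Option α → R => P (fun i => w (some i)) (w none))) :
    Dfp L (fun v => ∃ z, P v z) := by
  have := Set.Definable.image_comp h (some : α → Option α)
  unfold Dfp
  convert this using 1
  ext v
  constructor
  · rintro ⟨z, hz⟩
    exact ⟨fun o => o.elim z v, hz, rfl⟩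
  · rintro ⟨w, hw, rfl⟩
    exact ⟨w none, hw⟩

theorem dfp_all {α : Type*} [Finite α] {P : (α → R) → R → Prop}
    (h : Dfp L (fun w : Option α → R => P (fun i => w (some i)) (w none))) :
    Dfp L (fun v => ∀ z, P v z) := by
  have := dfp_not (dfp_ex (P := fun v z => ¬ P v z) (dfp_not h))
  simpa only [not_exists, not_not] using this

theorem dfp_lt [LT R] (hlt : IsDefinable L {v : Fin 2 → R | v 0 < v 1}) {α : Type*}
    {s t : (α → R) → R} (hs : Tmf L s) (ht : Tmf L t) : Dfp L (fun v => s v < t v) := by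
  have := dfp_atom hlt ![s, t] (by intro k; fin_cases k <;> assumption)
  simpa using this

theorem dfp_le [LinearOrder R] (hlt : IsDefinable L {v : Fin 2 → R | v 0 < v 1}) {α : Type*}
    {s t : (α → R) → R} (hs : Tmf L s) (ht : Tmf L t) : Dfp L (fun v => s v ≤ t v) := by
  have := dfp_not (dfp_lt hlt ht hs)
  simpa only [not_lt] using this

theorem dfp_add [Add R] (hadd : IsDefinable L {v : Fin 3 → R | v 0 + v 1 = v 2}) {α : Type*}
    {s t u : (α → R) → R} (hs : Tmf L s) (ht : Tmf L t) (hu : Tmf L u) :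
    Dfp L (fun v => s v + t v = u v) := by
  have := dfp_atom hadd ![s, t, u] (by intro k; fin_cases k <;> assumption)
  simpa using this

theorem dfp_fiber {m : ℕ} {X : Set (Fin (m + 1) → R)} (hX : IsDefinable L X) {α : Type*}
    {x : Fin m → (α → R) → R} {y : (α → R) → R} (hx : ∀ i, Tmf L (x i)) (hy : Tmf L y) :
    Dfp L (fun v => y v ∈ fiber1 X (fun i => x i v)) := by
  have := dfp_atom hX (Fin.snoc (α := fun _ => (α → R) → R) x y) (by
    intro k
    refine Fin.lastCases ?_ (fun i => ?_) k
    · simpa using hy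
    · simpa using hx i)
  convert this using 3 with v
  unfold fiber1
  simp only [Set.mem_ofPred_eq]
  congr! 1
  ext k
  refine Fin.lastCases ?_ (fun i => ?_) k <;> simp

/-- Definable subsets of the line. -/
def DefS (L : FirstOrder.Language) {R : Type*} [L.Structure R] (s : Set R) : Prop :=
  IsDefinable L {v : Fin 1 → R | v 0 ∈ s}

theorem defS_mem {s : Set R} (h : DefS L s) {α : Type*} {y : (α → R) → R} (hy : Tmf L y) :
    Dfp L (fun v => y v ∈ s) :=
  dfp_atom h (fun _ => y) (fun _ => hy)

theorem defS_fiber {m : ℕ} {X : Set (Fin (m + 1) → R)} (hX : IsDefinable L X)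
    (x : Fin m → R) : DefS L (fiber1 X x) :=
  dfp_fiber hX (x := fun i _ => x i) (fun _ => tmf_const _) (tmf_var 0)

theorem defS_glb [LinearOrder R] (hlt : IsDefinable L {v : Fin 2 → R | v 0 < v 1})
    (hDC : DCProp L R) {s : Set R} (h : DefS L s) (hne : s.Nonempty) (hb : BddBelow s) :
    ∃ g, IsGLB s g := by
  obtain ⟨g, hg⟩ := hDC (lowerBounds s) (by
    have : Dfp L (fun v : Fin 1 → R => ∀ z, z ∈ s → v 0 ≤ z) :=
      dfp_all (dfp_imp (defS_mem h (tmf_var _)) (dfp_le hlt (tmf_var _) (tmf_var _)))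
    exact this) hb (by
      obtain ⟨y, hy⟩ := hne
      exact ⟨y, fun z hz => hz hy⟩)
  exact ⟨g, isLUB_lowerBounds.1 hg⟩

end DefTools

section LineTools

variable {R : Type*} [LinearOrder R] [DenselyOrdered R] [AddCommGroup R]
  [IsOrderedAddMonoid R] [Nontrivial R] [TopologicalSpace R] [OrderTopology R]

theorem mem_int_iff (S : Set R) (y : R) :
    y ∈ interior S ↔ ∃ u v, u < y ∧ y < v ∧ ∀ z, u < z → z < v → z ∈ S := by
  rw [mem_interior_iff_mem_nhds, mem_nhds_iff_exists_Ioo_subset]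
  constructor
  · rintro ⟨u, v, ⟨h1, h2⟩, h⟩
    exact ⟨u, v, h1, h2, fun z a b => h ⟨a, b⟩⟩
  · rintro ⟨u, v, h1, h2, h⟩
    exact ⟨u, v, ⟨h1, h2⟩, fun z hz => h z hz.1 hz.2⟩

/-- Left endpoints of components of `V` of length at least `r`. -/
def leftEnds (V : Set R) (r : R) : Set R :=
  {y | y ∉ V ∧ y < y + r ∧ ∀ z, y < z → z < y + r → z ∈ V}

theorem leftEnds_sep {V : Set R} {r y z : R} (hy : y ∈ leftEnds V r) (hz : z ∈ leftEnds V r)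
    (h : y < z) : y + r ≤ z := by
  by_contra hc
  exact hz.1 (hy.2.2 z h (not_le.1 hc))

theorem exists_isLeast_of_glb {D : Set R} {r : R} (hr : 0 < r)
    (hsep : ∀ y ∈ D, ∀ z ∈ D, y < z → y + r ≤ z) {s : Set R} (hs : s ⊆ D) {g : R}
    (hg : IsGLB s g) : ∃ u, IsLeast s u := by
  obtain ⟨y, hy, h1, h2⟩ := hg.exists_between (lt_add_of_pos_right g hr)
  refine ⟨y, hy, fun z hz => ?_⟩
  by_contra hc
  have h3 := hsep z (hs hz) y (hs hy) (not_le.1 hc)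
  have h4 := hg.1 hz
  have h5 : g + r ≤ z + r := by gcongr
  exact absurd h2 (not_lt.2 (h5.trans h3))

theorem exists_initial {D : Set R} {s t : R} (hst : s ≤ t)
    (hleast : ∀ u, (D ∩ Set.Ioc u t).Nonempty → ∃ w, IsLeast (D ∩ Set.Ioc u t) w)
    (hinf : (D ∩ Set.Ioc s t).Infinite) (k : ℕ) :
    ∃ u, s ≤ u ∧ u ≤ t ∧ (D ∩ Set.Ioc s u).Finite ∧ (D ∩ Set.Ioc s u).ncard = k := by
  induction k with
  | zero => exact ⟨s, le_rfl, hst, by simp, by simp⟩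
  | succ k ih =>
    obtain ⟨u, h1, h2, h3, h4⟩ := ih
    obtain ⟨w, hw, hmin⟩ := hleast u (by
      by_contra hne
      refine hinf (h3.subset ?_)
      rintro z ⟨hz, hz1, hz2⟩
      refine ⟨hz, hz1, ?_⟩
      by_contra hc
      exact hne ⟨z, hz, not_le.1 hc, hz2⟩)
    have heq : D ∩ Set.Ioc s w = insert w (D ∩ Set.Ioc s u) := by
      ext z
      constructor
      · rintro ⟨hz, hz1, hz2⟩
        rcases le_or_gt z u with h | h
        · exact Or.inr ⟨hz, hz1, h⟩
        · exact Or.inl (le_antisymm hz2 (hmin ⟨hz, h, hz2.trans hw.2.2⟩))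
      · rintro (rfl | ⟨hz, hz1, hz2⟩)
        · exact ⟨hw.1, h1.trans_lt hw.2.1, le_rfl⟩
        · exact ⟨hz, hz1, hz2.trans hw.2.1.le⟩
    refine ⟨w, h1.trans hw.2.1.le, hw.2.2, ?_, ?_⟩
    · rw [heq]; exact h3.insert w
    · rw [heq, Set.ncard_insert_of_notMem ?_ h3, h4]
      exact fun h => absurd h.2.2 (not_le.2 hw.2.1)

theorem card_le_of_pieces {D : Set R} {p q : R} {N : ℕ}
    (hleast : ∀ s t, (D ∩ Set.Ioc s t).Nonempty → ∃ w, IsLeast (D ∩ Set.Ioc s t) w)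
    (hN : ∀ s t, p < s → s < q → p < t → t < q →
      (D ∩ Set.Ioc s t).Infinite ∨ (D ∩ Set.Ioc s t).ncard ≤ N)
    (F : Finset R) (hF : ↑F ⊆ D ∩ Set.Ioo p q) : F.card ≤ N := by
  rcases F.eq_empty_or_nonempty with rfl | hne
  · simp
  have hmin := hF (F.min'_mem hne)
  have hmax := hF (F.max'_mem hne)
  obtain ⟨s, hs1, hs2⟩ := exists_between hmin.2.1
  set t := F.max' hne with ht
  have hsub : (↑F : Set R) ⊆ D ∩ Set.Ioc s t := fun z hz =>
    ⟨(hF hz).1, hs2.trans_le (F.min'_le z hz), F.le_max' z hz⟩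
  have hst : s ≤ t := (hs2.trans_le (F.min'_le _ (F.max'_mem hne))).le
  by_cases hinf : (D ∩ Set.Ioc s t).Infinite
  · obtain ⟨u, h1, h2, h3, h4⟩ := exists_initial hst (fun u => hleast u t) hinf (N + 1)
    rcases hN s u hs1 (hst.trans_lt hmax.2.2) (hs1.trans_le h1) (h2.trans_lt hmax.2.2) with h | h
    · exact absurd h3 h
    · omega
  · rcases hN s t hs1 (hst.trans_lt hmax.2.2) hmax.2.1 hmax.2.2 with h | h
    · exact absurd h hinf
    · rw [← Set.ncard_coe_finset]
      exact (Set.ncard_le_ncard hsub (Set.not_infinite.1 hinf)).trans h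

theorem finite_ends {V : Set R} {p q ρ : R} (hρ : 0 < ρ) {N : ℕ}
    (h : ∀ r, 0 < r → r < ρ → ∀ F : Finset R, ↑F ⊆ leftEnds V r ∩ Set.Ioo p q → F.card ≤ N) :
    ∃ E : Finset R, E.card ≤ N ∧ ∀ y, p < y → y < q → (∃ r, y ∈ leftEnds V r) → y ∈ E := by
  classical
  set E : Set R := {y | p < y ∧ y < q ∧ ∃ r, y ∈ leftEnds V r} with hE
  have key : ∀ F : Finset R, ↑F ⊆ E → F.card ≤ N := by
    intro F hF
    have hev : ∀ y ∈ F, ∀ᶠ r in 𝓝[>] (0 : R), y ∈ leftEnds V r := by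
      intro y hy
      obtain ⟨h1, h2, r, h3, h4, h5⟩ := hF hy
      have hr : 0 < r := by simpa using h4
      filter_upwards [Ioo_mem_nhdsGT hr] with r' hr'
      exact ⟨h3, by simpa using hr'.1, fun z hz1 hz2 =>
        h5 z hz1 (hz2.trans (by simpa using hr'.2))⟩
    have hall : ∀ᶠ r in 𝓝[>] (0 : R), ∀ y ∈ F, y ∈ leftEnds V r :=
      (Filter.eventually_all_finset F).2 hev
    obtain ⟨r, hr, hr1, hr2⟩ := (hall.and (Ioo_mem_nhdsGT hρ)).exists
    exact h r hr1 hr2 F fun y hy => ⟨hr y hy, (hF hy).1, (hF hy).2.1⟩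
  have hfin : E.Finite := by
    by_contra hinf
    obtain ⟨F, hF, hc⟩ := Set.Infinite.exists_subset_card_eq hinf (N + 1)
    have := key F hF
    omega
  refine ⟨hfin.toFinset, key _ (by simp), fun y h1 h2 h3 => by simpa using ⟨h1, h2, h3⟩⟩

theorem union_shrink {N : ℕ} {V : Set R} {c d c' d' : R} (hc : c ≤ c') (hd : d' ≤ d)
    (h : UnionAtMostOpenIntervals N (V ∩ Set.Ioo c d)) :
    UnionAtMostOpenIntervals N (V ∩ Set.Ioo c' d') := by
  classical
  obtain ⟨Q, hQ, heq⟩ := h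
  refine ⟨Q.image (fun p => (max p.1 c', min p.2 d')), Finset.card_image_le.trans hQ, ?_⟩
  have : V ∩ Set.Ioo c' d' = (V ∩ Set.Ioo c d) ∩ Set.Ioo c' d' := by
    ext z
    constructor
    · rintro ⟨h1, h2, h3⟩
      exact ⟨⟨h1, hc.trans_lt h2, h3.trans_le hd⟩, h2, h3⟩
    · rintro ⟨⟨h1, -⟩, h2⟩
      exact ⟨h1, h2⟩
  rw [this, heq]
  ext z
  simp only [Set.mem_inter_iff, Set.mem_iUnion, Finset.mem_image, Set.mem_Ioo, exists_prop]
  constructor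
  · rintro ⟨⟨p, hp, h1, h2⟩, h3, h4⟩
    exact ⟨_, ⟨p, hp, rfl⟩, max_lt h1 h3, lt_min h2 h4⟩
  · rintro ⟨_, ⟨p, hp, rfl⟩, h1, h2⟩
    simp only [max_lt_iff, lt_min_iff] at h1 h2
    exact ⟨⟨p, hp, h1.1, h2.1⟩, h1.2, h2.2⟩

theorem union_mono {N M : ℕ} (hNM : N ≤ M) {s : Set R} (h : UnionAtMostOpenIntervals N s) :
    UnionAtMostOpenIntervals M s := by
  obtain ⟨Q, hQ, heq⟩ := h
  exact ⟨Q, hQ.trans hNM, heq⟩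

theorem icc_diff (c d : R) (Q : Finset (R × R)) :
    ∃ T : Finset (R × R), T.card ≤ 2 ^ Q.card ∧
      Set.Icc c d \ (⋃ p ∈ Q, Set.Ioo p.1 p.2) = ⋃ p ∈ T, Set.Icc p.1 p.2 := by
  classical
  induction Q using Finset.induction_on with
  | empty => exact ⟨{(c, d)}, by simp, by simp⟩
  | insert a Q ha ih =>
    obtain ⟨T, hT, heq⟩ := ih
    refine ⟨T.image (fun p => (p.1, min p.2 a.1)) ∪ T.image (fun p => (max p.1 a.2, p.2)), ?_, ?_⟩
    · rw [Finset.card_insert_of_notMem ha, pow_succ]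
      refine (Finset.card_union_le _ _).trans ?_
      have h1 := Finset.card_image_le (s := T) (f := fun p => (p.1, min p.2 a.1))
      have h2 := Finset.card_image_le (s := T) (f := fun p => (max p.1 a.2, p.2))
      omega
    · have : Set.Icc c d \ (⋃ p ∈ insert a Q, Set.Ioo p.1 p.2)
          = (Set.Icc c d \ (⋃ p ∈ Q, Set.Ioo p.1 p.2)) \ Set.Ioo a.1 a.2 := by
        rw [Finset.set_biUnion_insert, Set.sdiff_sdiff, Set.union_comm]
      rw [this, heq]
      ext z
      simp only [Set.mem_sdiff, Set.mem_iUnion, Finset.mem_union, Finset.mem_image, Set.mem_Ioo,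
        Set.mem_Icc, exists_prop]
      constructor
      · rintro ⟨⟨p, hp, h1, h2⟩, h3⟩
        rcases le_or_gt z a.1 with h | h
        · exact ⟨_, Or.inl ⟨p, hp, rfl⟩, h1, le_min h2 h⟩
        · exact ⟨_, Or.inr ⟨p, hp, rfl⟩, max_le h1 (not_lt.1 fun h' => h3 ⟨h, h'⟩), h2⟩
      · rintro ⟨_, (⟨p, hp, rfl⟩ | ⟨p, hp, rfl⟩), h1, h2⟩
        · simp only [le_min_iff] at h2
          exact ⟨⟨p, hp, h1, h2.1⟩, fun h => absurd h.1 (not_lt.2 h2.2)⟩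
        · simp only [max_le_iff] at h1
          exact ⟨⟨p, hp, h1.1, h2⟩, fun h => absurd h.2 (not_lt.2 h1.2)⟩

theorem closure_pieces {S : Set R} {N : ℕ} {p q c d : R} (hpc : p < c) (hcd : c < d) (hdq : d < q)
    (h : UnionAtMostOpenIntervals N (interior Sᶜ ∩ Set.Ioo p q)) (N₁ : ℕ) :
    UnionAtMostPtsClosedIntervals N₁ (2 ^ N) (closure S ∩ closure (Set.Ioo c d)) := by
  obtain ⟨Q, hQ, heq⟩ := h
  obtain ⟨T, hT, hTe⟩ := icc_diff c d Q
  refine ⟨∅, T, by simp, hT.trans (Nat.pow_le_pow_right (by norm_num) hQ), ?_⟩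
  rw [← hTe, ← heq, closure_Ioo hcd.ne, interior_compl]
  ext z
  simp only [Finset.coe_empty, Set.empty_union, Set.mem_inter_iff, Set.mem_sdiff, Set.mem_compl_iff]
  constructor
  · rintro ⟨h1, h2⟩
    exact ⟨h2, fun h => h.1 h1⟩
  · rintro ⟨h1, h2⟩
    refine ⟨?_, h1⟩
    by_contra hc
    exact h2 ⟨hc, hpc.trans_le h1.1, h1.2.trans_lt hdq⟩

end LineTools

section Core

variable {L : FirstOrder.Language} {R : Type*} [L.Structure R]
  [LinearOrder R] [DenselyOrdered R] [AddCommGroup R]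
  [IsOrderedAddMonoid R] [Nontrivial R] [TopologicalSpace R] [OrderTopology R]

theorem dfp_int (hlt : IsDefinable L {v : Fin 2 → R | v 0 < v 1})
    {m : ℕ} {X : Set (Fin (m + 1) → R)} (hX : IsDefinable L X) {α : Type*} [Finite α]
    (f : Fin m → α) (j : α) :
    Dfp L (fun v : α → R => v j ∈ interior (fiber1 X (fun i => v (f i)))) := by
  have : Dfp L (fun v : α → R => ∃ u w, u < v j ∧ v j < w ∧
      ∀ z, u < z → z < w → z ∈ fiber1 X (fun i => v (f i))) := by
    refine dfp_ex (dfp_ex ?_)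
    refine dfp_and (dfp_lt hlt (tmf_var _) (tmf_var _))
      (dfp_and (dfp_lt hlt (tmf_var _) (tmf_var _)) ?_)
    refine dfp_all (dfp_imp (dfp_lt hlt (tmf_var _) (tmf_var _))
      (dfp_imp (dfp_lt hlt (tmf_var _) (tmf_var _)) ?_))
    exact dfp_fiber hX (x := fun i w => w (some (some (some (f i))))) (fun _ => tmf_var _)
      (tmf_var _)
  simpa only [mem_int_iff] using this

/-- The family of left ends. -/
def endsFam {m : ℕ} (X : Set (Fin (m + 1) → R)) : Set (Fin (m + 3 + 1) → R) :=
  {w | w (Fin.last _) ∈ leftEnds (interior (fiber1 X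
      (fun i : Fin m => w (Fin.castSucc (Fin.castAdd 3 i))))) (w (Fin.castSucc (Fin.natAdd m 0))) ∧
    w (Fin.castSucc (Fin.natAdd m 1)) < w (Fin.last _) ∧
    w (Fin.last _) ≤ w (Fin.castSucc (Fin.natAdd m 2))}

theorem endsFam_def (hlt : IsDefinable L {v : Fin 2 → R | v 0 < v 1})
    (hadd : IsDefinable L {v : Fin 3 → R | v 0 + v 1 = v 2})
    {m : ℕ} {X : Set (Fin (m + 1) → R)} (hX : IsDefinable L X) :
    IsDefinable L (endsFam X) := by
  refine dfp_and ?_ (dfp_and (dfp_lt hlt (tmf_var _) (tmf_var _))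
    (dfp_le hlt (tmf_var _) (tmf_var _)))
  refine dfp_and (dfp_not (dfp_int hlt hX _ _)) ?_
  have : Dfp L (fun w : Fin (m + 3 + 1) → R => ∃ u,
      w (Fin.last _) + w (Fin.castSucc (Fin.natAdd m 0)) = u ∧ w (Fin.last _) < u ∧
      ∀ z, w (Fin.last _) < z → z < u → z ∈ interior (fiber1 X
        (fun i : Fin m => w (Fin.castSucc (Fin.castAdd 3 i))))) := by
    refine dfp_ex (dfp_and (dfp_add hadd (tmf_var _) (tmf_var _) (tmf_var _))
      (dfp_and (dfp_lt hlt (tmf_var _) (tmf_var _)) ?_))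
    refine dfp_all (dfp_imp (dfp_lt hlt (tmf_var _) (tmf_var _))
      (dfp_imp (dfp_lt hlt (tmf_var _) (tmf_var _)) ?_))
    exact dfp_int hlt hX (fun i => some (some (Fin.castSucc (Fin.castAdd 3 i)))) none
  simpa only [exists_eq_left'] using this

theorem endsFam_fiber {m : ℕ} (X : Set (Fin (m + 1) → R)) (x : Fin m → R) (r s t : R) :
    fiber1 (endsFam X) (Fin.append x ![r, s, t]) =
      leftEnds (interior (fiber1 X x)) r ∩ Set.Ioc s t := by
  ext y
  simp only [fiber1, endsFam, Set.mem_ofPred_eq, Fin.snoc_last, Fin.snoc_castSucc,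
    Fin.append_left, Fin.append_right]
  rfl

theorem pieces_of_ends (hlt : IsDefinable L {v : Fin 2 → R | v 0 < v 1}) (hDC : DCProp L R)
    {V : Set R} (hV : IsOpen V) (hVd : DefS L V) {p q : R} (hpq : p < q) {N : ℕ} {E : Finset R}
    (hE : E.card ≤ N)
    (hE' : ∀ y, p < y → y < q → (∃ r, y ∈ leftEnds V r) → y ∈ E) :
    UnionAtMostOpenIntervals (N + 1) (V ∩ Set.Ioo p q) := by
  classical
  have hf : ∀ e, ∃ f, (∀ z, e < z → z < f → z ∈ V ∧ z < q) ∧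
      (∀ y, e ≤ y → y ≤ q → (∀ z, e < z → z < y → z ∈ V) → y ≤ f) := by
    intro e
    rcases le_or_gt e q with he | he
    · obtain ⟨f, hf⟩ := hDC {y | e ≤ y ∧ y ≤ q ∧ ∀ z, e < z → z < y → z ∈ V} (by
        refine dfp_and (dfp_le hlt (tmf_const _) (tmf_var _))
          (dfp_and (dfp_le hlt (tmf_var _) (tmf_const _)) ?_)
        exact dfp_all (dfp_imp (dfp_lt hlt (tmf_const _) (tmf_var _))
          (dfp_imp (dfp_lt hlt (tmf_var _) (tmf_var _)) (defS_mem hVd (tmf_var _)))))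
        ⟨e, le_rfl, he, fun z h1 h2 => absurd h1 h2.not_gt⟩ ⟨q, fun y hy => hy.2.1⟩
      refine ⟨f, fun z h1 h2 => ?_, fun y h1 h2 h3 => hf.1 ⟨h1, h2, h3⟩⟩
      obtain ⟨y, hy, h3, -⟩ := hf.exists_between h2
      exact ⟨hy.2.2 z h1 h3, h3.trans_le hy.2.1⟩
    · exact ⟨e, fun z h1 h2 => absurd h1 h2.not_gt,
        fun y h1 h2 => absurd (h1.trans h2) (not_le.2 he)⟩
  choose f hf1 hf2 using hf
  refine ⟨(insert p (E.filter (fun e => p < e))).image (fun e => (e, f e)), ?_, ?_⟩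
  · refine Finset.card_image_le.trans ((Finset.card_insert_le _ _).trans ?_)
    have := Finset.card_filter_le E (fun e => p < e)
    omega
  ext v
  simp only [Set.mem_iUnion, Finset.mem_image, exists_prop]
  constructor
  · rintro ⟨hv, hpv, hvq⟩
    obtain ⟨e, he⟩ := hDC {y | p ≤ y ∧ y ≤ v ∧ (y ≤ p ∨ y ∉ V)} (by
        refine dfp_and (dfp_le hlt (tmf_const _) (tmf_var _))
          (dfp_and (dfp_le hlt (tmf_var _) (tmf_const _)) ?_)
        exact dfp_or (dfp_le hlt (tmf_var _) (tmf_const _)) (dfp_not (defS_mem hVd (tmf_var _))))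
        ⟨p, le_rfl, hpv.le, Or.inl le_rfl⟩ ⟨v, fun y hy => hy.2.1⟩
    have hpe : p ≤ e := he.1 ⟨le_rfl, hpv.le, Or.inl le_rfl⟩
    obtain ⟨u, w, ⟨huv, hvw⟩, huw⟩ := mem_nhds_iff_exists_Ioo_subset.1 (hV.mem_nhds hv)
    have hev : e < v := by
      have : e ≤ max u p := he.2 (by
        rintro y ⟨h1, h2, h3 | h3⟩
        · exact h3.trans (le_max_right _ _)
        · refine le_trans ?_ (le_max_left _ _)
          by_contra hc
          exact h3 (huw ⟨not_le.1 hc, h2.trans_lt hvw⟩))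
      exact this.trans_lt (max_lt huv hpv)
    have hV1 : ∀ z, e < z → z ≤ v → z ∈ V := by
      intro z h1 h2
      by_contra hc
      exact absurd (he.1 ⟨hpe.trans h1.le, h2, Or.inr hc⟩) (not_le.2 h1)
    have hfe : v < f e := by
      refine lt_of_lt_of_le (lt_min hvw hvq)
        (hf2 e (min w q) (hev.le.trans (le_min hvw.le hvq.le)) (min_le_right _ _) ?_)
      intro z h1 h2
      rcases le_or_gt z v with h | h
      · exact hV1 z h1 h
      · exact huw ⟨huv.trans h, h2.trans_le (min_le_left _ _)⟩
    refine ⟨_, ⟨e, ?_, rfl⟩, hev, hfe⟩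
    rcases hpe.eq_or_lt with h | h
    · rw [← h]; exact Finset.mem_insert_self _ _
    · refine Finset.mem_insert_of_mem (Finset.mem_filter.2 ⟨?_, h⟩)
      refine hE' e h (hev.trans hvq) ⟨v - e, ?_, by simpa using hev, fun z h1 h2 =>
        hV1 z h1 (by simpa using h2.le)⟩
      intro heV
      obtain ⟨u', w', ⟨hu', hw'⟩, huw'⟩ := mem_nhds_iff_exists_Ioo_subset.1 (hV.mem_nhds heV)
      have : e ≤ max u' p := he.2 (by
        rintro y hy
        have hye := he.1 hy
        obtain ⟨h1, h2, h3 | h3⟩ := hy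
        · exact h3.trans (le_max_right _ _)
        · refine le_trans ?_ (le_max_left _ _)
          by_contra hc
          exact h3 (huw' ⟨not_le.1 hc, hye.trans_lt hw'⟩))
      exact absurd this (not_le.2 (max_lt hu' h))
  · rintro ⟨_, ⟨e, he, rfl⟩, h1, h2⟩
    have hpe : p ≤ e := by
      rcases Finset.mem_insert.1 he with rfl | h
      · exact le_rfl
      · exact (Finset.mem_filter.1 h).2.le
    exact ⟨(hf1 e v h1 h2).1, hpe.trans_lt h1, (hf1 e v h1 h2).2⟩

theorem core (hlt : IsDefinable L {v : Fin 2 → R | v 0 < v 1})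
    (hadd : IsDefinable L {v : Fin 3 → R | v 0 + v 1 = v 2}) (hDC : DCProp L R)
    {m : ℕ} {X : Set (Fin (m + 1) → R)} (hX : IsDefinable L X) (x : Fin m → R)
    {P Q p q ρ : R} {N : ℕ} (hρ : 0 < ρ) (hPp : P ≤ p) (hpq : p < q) (hqQ : q ≤ Q)
    (h : ∀ r s t, 0 < r → r < ρ → p < s → s < q → p < t → t < q →
      (fiber1 (endsFam X) (Fin.append x ![r, s, t]) ∩ Set.Icc P Q).Infinite ∨
      (fiber1 (endsFam X) (Fin.append x ![r, s, t]) ∩ Set.Icc P Q).ncard ≤ N) :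
    UnionAtMostOpenIntervals (N + 1) (interior (fiber1 X x) ∩ Set.Ioo p q) := by
  have hends : ∀ r, 0 < r → r < ρ → ∀ F : Finset R,
      ↑F ⊆ leftEnds (interior (fiber1 X x)) r ∩ Set.Ioo p q → F.card ≤ N := by
    intro r hr hrρ
    refine card_le_of_pieces ?_ ?_
    · intro s t hne
      obtain ⟨g, hg⟩ := defS_glb hlt hDC (s := leftEnds (interior (fiber1 X x)) r ∩ Set.Ioc s t)
        (by rw [← endsFam_fiber]; exact defS_fiber (endsFam_def hlt hadd hX) _) hne
        ⟨s, fun y hy => hy.2.1.le⟩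
      exact exists_isLeast_of_glb hr (fun y hy z hz => leftEnds_sep hy hz)
        Set.inter_subset_left hg
    · intro s t h1 h2 h3 h4
      have := h r s t hr hrρ h1 h2 h3 h4
      rw [endsFam_fiber, Set.inter_eq_left.2] at this
      · exact this
      · rintro y ⟨-, hy1, hy2⟩
        exact ⟨hPp.trans (h1.trans hy1).le, hy2.trans (h4.le.trans hqQ)⟩
  obtain ⟨E, hE, hE'⟩ := finite_ends hρ hends
  refine pieces_of_ends hlt hDC isOpen_interior ?_ hpq hE hE'
  have : Dfp L (fun v : Fin 1 → R => ∃ u w, u < v 0 ∧ v 0 < w ∧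
      ∀ z, u < z → z < w → z ∈ fiber1 X x) := by
    refine dfp_ex (dfp_ex ?_)
    refine dfp_and (dfp_lt hlt (tmf_var _) (tmf_var _))
      (dfp_and (dfp_lt hlt (tmf_var _) (tmf_var _)) ?_)
    exact dfp_all (dfp_imp (dfp_lt hlt (tmf_var _) (tmf_var _))
      (dfp_imp (dfp_lt hlt (tmf_var _) (tmf_var _)) (defS_mem (defS_fiber hX x) (tmf_var _))))
  show Dfp L (fun v : Fin 1 → R => v 0 ∈ interior (fiber1 X x))
  simpa only [mem_int_iff] using this

theorem core2 (hlt : IsDefinable L {v : Fin 2 → R | v 0 < v 1})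
    (hadd : IsDefinable L {v : Fin 3 → R | v 0 + v 1 = v 2}) (hDC : DCProp L R)
    (hL : LUF2 L R)
    {m : ℕ} {X : Set (Fin (m + 1) → R)} (hX : IsDefinable L X) (b : Fin m → R) (a : R) :
    ∃ N c d, c < a ∧ a < d ∧ ∃ l u : Fin m → R, (∀ i, l i < b i ∧ b i < u i) ∧
      ∀ x, (∀ i, l i < x i ∧ x i < u i) →
        UnionAtMostOpenIntervals N (interior (fiber1 X x) ∩ Set.Ioo c d) := by
  obtain ⟨N, -, P, Q, ha, _, ⟨l, u, rfl⟩, hb, h⟩ := hL _ _ (endsFam_def hlt hadd hX) a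
    (Fin.append b ![0, a, a])
  have ha' := ha
  rw [interior_Icc] at ha'
  have hb0 := hb (Fin.natAdd m 0)
  have hb1 := hb (Fin.natAdd m 1)
  have hb2 := hb (Fin.natAdd m 2)
  simp only [Fin.append_right] at hb0 hb1 hb2
  change l _ < 0 ∧ 0 < u _ at hb0
  change l _ < a ∧ a < u _ at hb1
  change l _ < a ∧ a < u _ at hb2
  refine ⟨N + 1, max P (max (l (Fin.natAdd m 1)) (l (Fin.natAdd m 2))),
    min Q (min (u (Fin.natAdd m 1)) (u (Fin.natAdd m 2))), max_lt ha'.1 (max_lt hb1.1 hb2.1),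
    lt_min ha'.2 (lt_min hb1.2 hb2.2), fun i => l (Fin.castAdd 3 i), fun i => u (Fin.castAdd 3 i),
    fun i => by simpa using hb (Fin.castAdd 3 i), fun x hx => ?_⟩
  refine core hlt hadd hDC hX x hb0.2 (le_max_left _ _)
    ((max_lt ha'.1 (max_lt hb1.1 hb2.1)).trans (lt_min ha'.2 (lt_min hb1.2 hb2.2)))
    (min_le_left _ _) ?_
  intro r s t hr hrρ h1 h2 h3 h4
  refine h _ ?_ P Q ha subset_rfl
  simp only [max_lt_iff, lt_min_iff] at h1 h2 h3 h4
  intro k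
  refine Fin.addCases (fun i => ?_) (fun j => ?_) k
  · simpa using hx i
  · simp only [Fin.append_right]
    fin_cases j
    · exact ⟨hb0.1.trans hr, hrρ⟩
    · exact ⟨h1.2.1, h2.2.1⟩
    · exact ⟨h3.2.2, h4.2.2⟩

end Core


/-- (Interior and closure of fibers consist of boundedly many pieces,
with the `LUF₁` and `SLUF` refinements.) Let `𝓡` be a definably complete expansion of a
densely linearly ordered abelian group satisfying `LUF₂`. For any definable
`X ⊆ R^{m+1}` and `(b,a) ∈ R^m × R` there are positive integers `N₁, N₂`, an open
interval `I ∋ a` and an open box `U ∋ b` such that for every `x ∈ U`,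
`int(X_x) ∩ I` is a union of at most `N₁` open intervals and `cl(X_x) ∩ cl(I)` is a
union of at most `N₁` points and `N₂` closed intervals. Moreover `U` can be taken to be
`R^m` if `𝓡 ⊨ LUF₁`, and `I` can be taken independently of `X` if `𝓡 ⊨ SLUF`. -/
theorem interior_closure_fibers_boundedly_many_pieces
    {R : Type*} (L : FirstOrder.Language) [L.Structure R]
    [LinearOrder R] [DenselyOrdered R] [AddCommGroup R]
    [CovariantClass R R (· + ·) (· < ·)] [TopologicalSpace R] [OrderTopology R]
    (hlt : IsDefinable L {v : Fin 2 → R | v 0 < v 1})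
    (hadd : IsDefinable L {v : Fin 3 → R | v 0 + v 1 = v 2})
    (hDC : DCProp L R) (hLUF2 : LUF2 L R) :
    (∀ (m : ℕ) (X : Set (Fin (m + 1) → R)), IsDefinable L X →
      ∀ (b : Fin m → R) (a : R),
        ∃ N₁ N₂ : ℕ, 0 < N₁ ∧ 0 < N₂ ∧ ∃ c d : R, c < a ∧ a < d ∧
          ∃ U : Set (Fin m → R), OpenBox U ∧ b ∈ U ∧
            ∀ x ∈ U,
              UnionAtMostOpenIntervals N₁ (interior (fiber1 X x) ∩ Set.Ioo c d) ∧
              UnionAtMostPtsClosedIntervals N₁ N₂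
                (closure (fiber1 X x) ∩ closure (Set.Ioo c d))) ∧
    (LUF1 L R → ∀ (m : ℕ) (X : Set (Fin (m + 1) → R)), IsDefinable L X → ∀ a : R,
      ∃ N₁ N₂ : ℕ, 0 < N₁ ∧ 0 < N₂ ∧ ∃ c d : R, c < a ∧ a < d ∧
        ∀ x : Fin m → R,
          UnionAtMostOpenIntervals N₁ (interior (fiber1 X x) ∩ Set.Ioo c d) ∧
          UnionAtMostPtsClosedIntervals N₁ N₂
            (closure (fiber1 X x) ∩ closure (Set.Ioo c d))) ∧
    (SLUF L R → ∀ a : R, ∃ c d : R, c < a ∧ a < d ∧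
      ∀ (m : ℕ) (X : Set (Fin (m + 1) → R)), IsDefinable L X →
        ∃ N₁ N₂ : ℕ, 0 < N₁ ∧ 0 < N₂ ∧
          ∀ x : Fin m → R,
            UnionAtMostOpenIntervals N₁ (interior (fiber1 X x) ∩ Set.Ioo c d) ∧
            UnionAtMostPtsClosedIntervals N₁ N₂
              (closure (fiber1 X x) ∩ closure (Set.Ioo c d))) := by
  haveI : IsOrderedAddMonoid R :=
    { add_le_add_left := fun a b h c => by
        rcases h.eq_or_lt with rfl | h
        · exact le_rfl
        · have := CovariantClass.elim (μ := fun x y : R => x + y) (r := fun x y : R => x < y) c h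
          simpa only [add_comm] using this.le }
  haveI : Nontrivial R := by
    obtain ⟨N, -, p, q, -, _, ⟨l, u, rfl⟩, hb, -⟩ := hLUF2 1 Set.univ Set.definable_univ
      (0 : R) (fun _ => 0)
    exact ⟨⟨_, _, (hb 0).1.ne⟩⟩
  -- assembling the two applications
  have final : ∀ {m : ℕ} (X : Set (Fin (m + 1) → R)) (x : Fin m → R) (N M : ℕ)
      (p q c d : R), p < c → c < d → d < q →
      UnionAtMostOpenIntervals N (interior (fiber1 X x) ∩ Set.Ioo p q) →
      UnionAtMostOpenIntervals M (interior (fiber1 Xᶜ x) ∩ Set.Ioo p q) →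
      UnionAtMostOpenIntervals (N + 1) (interior (fiber1 X x) ∩ Set.Ioo c d) ∧
      UnionAtMostPtsClosedIntervals (N + 1) (2 ^ M)
        (closure (fiber1 X x) ∩ closure (Set.Ioo c d)) := by
    intro m X x N M p q c d hpc hcd hdq h1 h2
    exact ⟨union_mono (Nat.le_succ N) (union_shrink hpc.le hdq.le h1),
      closure_pieces hpc hcd hdq h2 _⟩
  obtain ⟨ρ, hρ⟩ := exists_gt (0 : R)
  refine ⟨?_, ?_, ?_⟩
  · intro m X hX b a
    obtain ⟨N, c, d, hc, hd, l, u, hb, h⟩ := core2 hlt hadd hDC hLUF2 hX b a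
    obtain ⟨M, c', d', hc', hd', l', u', hb', h'⟩ :=
      core2 hlt hadd hDC hLUF2 (Set.Definable.compl hX) b a
    obtain ⟨c₂, h1, h2⟩ := exists_between (max_lt hc hc')
    obtain ⟨d₂, h3, h4⟩ := exists_between (lt_min hd hd')
    refine ⟨N + 1, 2 ^ M, Nat.succ_pos _, by positivity, c₂, d₂, h2, h3, _,
      ⟨fun i => max (l i) (l' i), fun i => min (u i) (u' i), rfl⟩, ?_, ?_⟩
    · exact fun i => ⟨max_lt (hb i).1 (hb' i).1, lt_min (hb i).2 (hb' i).2⟩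
    · intro x hx
      refine final X x N M _ _ c₂ d₂ h1 (h2.trans h3) h4
        (union_shrink (le_max_left _ _) (min_le_left _ _) (h x fun i => ?_))
        (union_shrink (le_max_right _ _) (min_le_right _ _) (h' x fun i => ?_))
      · exact ⟨(le_max_left _ _).trans_lt (hx i).1, (hx i).2.trans_le (min_le_left _ _)⟩
      · exact ⟨(le_max_right _ _).trans_lt (hx i).1, (hx i).2.trans_le (min_le_right _ _)⟩
  · intro hL m X hX a
    obtain ⟨N, -, c, d, ha, h⟩ := hL _ _ (endsFam_def hlt hadd hX) a
    obtain ⟨M, -, c', d', ha', h'⟩ :=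
      hL _ _ (endsFam_def hlt hadd (Set.Definable.compl hX)) a
    have hb := ha
    have hb' := ha'
    rw [interior_Icc] at hb hb'
    obtain ⟨c₂, h1, h2⟩ := exists_between (max_lt hb.1 hb'.1)
    obtain ⟨d₂, h3, h4⟩ := exists_between (lt_min hb.2 hb'.2)
    refine ⟨N + 1 + 1, 2 ^ (M + 1), Nat.succ_pos _, by positivity, c₂, d₂, h2, h3, fun x => ?_⟩
    refine final X x (N + 1) (M + 1) _ _ c₂ d₂ h1 (h2.trans h3) h4
      (union_shrink (le_max_left _ _) (min_le_left _ _)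
        (core hlt hadd hDC hX x hρ le_rfl (hb.1.trans hb.2) le_rfl ?_))
      (union_shrink (le_max_right _ _) (min_le_right _ _)
        (core hlt hadd hDC (Set.Definable.compl hX) x hρ le_rfl (hb'.1.trans hb'.2) le_rfl ?_))
    · intro r s t _ _ _ _ _ _
      exact h _ _ _ ha subset_rfl
    · intro r s t _ _ _ _ _ _
      exact h' _ _ _ ha' subset_rfl
  · intro hL a
    obtain ⟨c, d, ha, hS⟩ := hL a
    have hb := ha
    rw [interior_Icc] at hb
    obtain ⟨c₂, h1, h2⟩ := exists_between hb.1
    obtain ⟨d₂, h3, h4⟩ := exists_between hb.2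
    refine ⟨c₂, d₂, h2, h3, fun m X hX => ?_⟩
    obtain ⟨N, -, h⟩ := hS _ _ (endsFam_def hlt hadd hX)
    obtain ⟨M, -, h'⟩ := hS _ _ (endsFam_def hlt hadd (Set.Definable.compl hX))
    refine ⟨N + 1 + 1, 2 ^ (M + 1), Nat.succ_pos _, by positivity, fun x => ?_⟩
    refine final X x (N + 1) (M + 1) _ _ c₂ d₂ h1 (h2.trans h3) h4
      (core hlt hadd hDC hX x hρ le_rfl (hb.1.trans hb.2) le_rfl ?_)
      (core hlt hadd hDC (Set.Definable.compl hX) x hρ le_rfl (hb.1.trans hb.2) le_rfl ?_)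
    · intro r s t _ _ _ _ _ _
      exact h _ _ _ ha subset_rfl
    · intro r s t _ _ _ _ _ _
      exact h' _ _ _ ha subset_rfl
end

section
/- Let 𝓡 = (R, <, +, 0, …) be an expansion of a densely linearly ordered abelian group with 𝓡 ⊨ DC and 𝓡 ⊨ LUF₂. Let {X_{r,s}}_{r>0,s>0} be a D_Σ-family of subsets of R^n and set X = ⋃_{r>0,s>0} X_{r,s}. Then at least one of the following holds: (i) X has empty interior, and moreover X is locally finite when n = 1; (ii) X_{r,s} has nonempty interior for some r > 0 and s > 0. -/
open FirstOrder Set Topology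

set_option linter.unusedSectionVars false
set_option linter.unusedVariables false

namespace DS

section Logic

variable {R : Type*} {L : FirstOrder.Language} [L.Structure R]

/-- Definable predicates, in an arbitrary context of variables. -/
def DefP (L : FirstOrder.Language) [L.Structure R] {α : Type} (P : (α → R) → Prop) : Prop :=
  (Set.univ : Set R).Definable L {v | P v}

/-- Definable functions. -/
def DFun (L : FirstOrder.Language) [L.Structure R] {α : Type} (f : (α → R) → R) : Prop :=
  (Set.univ : Set R).DefinableFun L f

variable {α β : Type}

theorem DefP.congr {P Q : (α → R) → Prop} (h : DefP L P) (hPQ : ∀ v, Q v ↔ P v) : DefP L Q := by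
  have : Q = P := funext fun v => propext (hPQ v)
  rw [this]; exact h

theorem DefP.and {P Q : (α → R) → Prop} (hP : DefP L P) (hQ : DefP L Q) :
    DefP L (fun v => P v ∧ Q v) := Set.Definable.inter hP hQ

theorem DefP.or {P Q : (α → R) → Prop} (hP : DefP L P) (hQ : DefP L Q) :
    DefP L (fun v => P v ∨ Q v) := Set.Definable.union hP hQ

theorem DefP.not {P : (α → R) → Prop} (hP : DefP L P) :
    DefP L (fun v => ¬ P v) := Set.Definable.compl hP

theorem DefP.imp {P Q : (α → R) → Prop} (hP : DefP L P) (hQ : DefP L Q) :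
    DefP L (fun v => P v → Q v) :=
  (hP.not.or hQ).congr fun v => by tauto

theorem DefP.exN {P : (α → R) → (β → R) → Prop} [Finite β]
    (h : DefP L (fun w : α ⊕ β → R => P (fun a => w (Sum.inl a)) (fun b => w (Sum.inr b)))) :
    DefP L (fun v => ∃ y, P v y) := by
  have := Set.Definable.exists_of_finite h
  exact this

theorem DefP.ex {P : (α → R) → R → Prop}
    (h : DefP L (fun w : α ⊕ Unit → R => P (fun a => w (Sum.inl a)) (w (Sum.inr ())))) :
    DefP L (fun v => ∃ y, P v y) := by
  have := DefP.exN (P := fun v (u : Unit → R) => P v (u ())) h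
  refine this.congr fun v => ⟨fun ⟨y, hy⟩ => ⟨fun _ => y, hy⟩, fun ⟨y, hy⟩ => ⟨y (), hy⟩⟩

theorem DefP.allN {P : (α → R) → (β → R) → Prop} [Finite β]
    (h : DefP L (fun w : α ⊕ β → R => P (fun a => w (Sum.inl a)) (fun b => w (Sum.inr b)))) :
    DefP L (fun v => ∀ y, P v y) := by
  refine (DefP.not (DefP.exN (P := fun v y => ¬ P v y) h.not)).congr fun v => ?_
  simp

theorem DefP.all {P : (α → R) → R → Prop}
    (h : DefP L (fun w : α ⊕ Unit → R => P (fun a => w (Sum.inl a)) (w (Sum.inr ())))) :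
    DefP L (fun v => ∀ y, P v y) := by
  refine (DefP.not (DefP.ex (P := fun v y => ¬ P v y) h.not)).congr fun v => ?_
  simp

theorem DefP.allFin {ι : Type} [Finite ι] {P : (α → R) → ι → Prop}
    (h : ∀ i, DefP L (fun v => P v i)) : DefP L (fun v => ∀ i, P v i) := by
  have := Set.definable_iInter_of_finite (f := fun i => {v | P v i}) h
  unfold DefP
  convert! this using 1
  ext v; simp

theorem DefP.subst [Finite β] {Q : (β → R) → Prop} (hQ : DefP L Q) {g : (α → R) → β → R}
    (hg : ∀ i, DFun L (fun v => g v i)) : DefP L (fun v => Q (g v)) :=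
  Set.Definable.preimage_map (F := g) hg hQ

theorem DefP.subst1 {Q : R → Prop} (hQ : DefP L (fun v : Fin 1 → R => Q (v 0)))
    {f : (α → R) → R} (hf : DFun L f) : DefP L (fun v => Q (f v)) :=
  hQ.subst (g := fun v => ![f v]) (by intro i; fin_cases i; exact hf)

theorem DefP.subst2 {Q : R → R → Prop} (hQ : DefP L (fun v : Fin 2 → R => Q (v 0) (v 1)))
    {f g : (α → R) → R} (hf : DFun L f) (hg : DFun L g) : DefP L (fun v => Q (f v) (g v)) :=
  hQ.subst (g := fun v => ![f v, g v]) (by intro i; fin_cases i <;> assumption)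

theorem DefP.subst3 {Q : R → R → R → Prop}
    (hQ : DefP L (fun v : Fin 3 → R => Q (v 0) (v 1) (v 2)))
    {f g h : (α → R) → R} (hf : DFun L f) (hg : DFun L g) (hh : DFun L h) :
    DefP L (fun v => Q (f v) (g v) (h v)) :=
  hQ.subst (g := fun v => ![f v, g v, h v]) (by intro i; fin_cases i <;> assumption)

theorem DFun.proj (i : α) : DFun L (fun v : α → R => v i) := Set.DefinableFun.proj L

theorem DFun.const (a : R) : DFun L (fun _ : α → R => a) :=
  L.definableFun_const α (Set.mem_univ a)

theorem DefP.const (p : Prop) : DefP L (fun _ : α → R => p) := by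
  by_cases h : p
  · simp only [h]; exact Set.definable_univ
  · simp only [h]; exact Set.definable_empty

theorem DefP.eq {f g : (α → R) → R} (hf : DFun L f) (hg : DFun L g) :
    DefP L (fun v => f v = g v) := Set.DefinableFun.ofPred_eq hf hg

end Logic

/-- The standing assumptions on definability of the ordered group operations. -/
structure Base (L : FirstOrder.Language) (R : Type*) [L.Structure R] [LinearOrder R]
    [AddCommGroup R] : Prop where
  lt : DefP L (fun v : Fin 2 → R => v 0 < v 1)
  add : DefP L (fun v : Fin 3 → R => v 0 + v 1 = v 2)

section OG

variable {R : Type*} {L : FirstOrder.Language} [L.Structure R] [LinearOrder R] [AddCommGroup R]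
variable {α β : Type}

theorem Base.lt' (B : Base L R) {f g : (α → R) → R} (hf : DFun L f) (hg : DFun L g) :
    DefP L (fun v => f v < g v) := B.lt.subst2 (Q := fun a b => a < b) hf hg

theorem Base.le' (B : Base L R) {f g : (α → R) → R} (hf : DFun L f) (hg : DFun L g) :
    DefP L (fun v => f v ≤ g v) := (B.lt' hg hf).not.congr fun v => by simp

theorem Base.add' (B : Base L R) {f g : (α → R) → R} (hf : DFun L f) (hg : DFun L g)  :
    DFun L (fun v => f v + g v) := by
  have h0 : DFun L (fun v : Fin 2 → R => v 0 + v 1) := by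
    have := Set.Definable.preimage_comp (β := Option (Fin 2)) ![some 0, some 1, none] B.add
    exact this
  exact Set.DefinableFun.comp (g := fun v => ![f v, g v])
    (by intro i; fin_cases i <;> assumption) h0

theorem Base.sub' (B : Base L R) {f g : (α → R) → R} (hf : DFun L f) (hg : DFun L g)  :
    DFun L (fun v => f v - g v) := by
  have h0 : DFun L (fun v : Fin 2 → R => v 0 - v 1) := by
    have := Set.Definable.preimage_comp (β := Option (Fin 2)) ![none, some 1, some 0] B.add
    have h2 : DefP L (fun w : Option (Fin 2) → R => w none + w (some 1) = w (some 0)) := this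
    refine h2.congr (Q := fun w => w ∈ Function.tupleGraph (fun v : Fin 2 → R => v 0 - v 1)) ?_
    intro v
    simp only [Function.tupleGraph, Set.mem_ofPred_eq, Function.comp]
    constructor
    · intro h; rw [← h]; abel
    · intro h; rw [← h]; abel
  exact Set.DefinableFun.comp (g := fun v => ![f v, g v])
    (by intro i; fin_cases i <;> assumption) h0

end OG

section OneDim

variable {R : Type*} {L : FirstOrder.Language} [L.Structure R] [LinearOrder R] [AddCommGroup R]
  [IsOrderedAddMonoid R] [DenselyOrdered R] [Nontrivial R] [TopologicalSpace R] [OrderTopology R]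

theorem exists_double (s : R) (hs : 0 < s) : ∃ d : R, 0 < d ∧ d + d ≤ s := by
  obtain ⟨e, he, hes⟩ := exists_between hs
  rcases le_total (e + e) s with h | h
  · exact ⟨e, he, h⟩
  · exact ⟨s - e, by grind, by grind⟩

theorem mem_nhds_iff1 {S : Set R} {a : R} :
    S ∈ 𝓝 a ↔ ∃ e, 0 < e ∧ ∀ y, a - e < y → y < a + e → y ∈ S := by
  rw [mem_nhds_iff_exists_Ioo_subset]
  constructor
  · rintro ⟨l, u, ⟨hl, hu⟩, h⟩
    refine ⟨min (a - l) (u - a), by grind, fun y h1 h2 => h ⟨by grind, by grind⟩⟩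
  · rintro ⟨e, he, h⟩
    exact ⟨a - e, a + e, ⟨by grind, by grind⟩, fun y hy => h y hy.1 hy.2⟩

theorem mem_nhds_iffN {n : ℕ} {S : Set (Fin n → R)} {a : Fin n → R} :
    S ∈ 𝓝 a ↔ ∃ e, 0 < e ∧ ∀ y : Fin n → R, (∀ i, a i - e < y i ∧ y i < a i + e) → y ∈ S := by
  constructor
  · intro h
    rw [nhds_pi, Filter.mem_pi] at h
    obtain ⟨I, hI, t, ht, hS⟩ := h
    choose e he hte using fun i => mem_nhds_iff1.1 (ht i)
    have key : ∀ J : Finset (Fin n), ∃ d, 0 < d ∧ ∀ i ∈ J, d ≤ e i := by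
      intro J
      induction J using Finset.induction_on with
      | empty =>
        obtain ⟨d, hd⟩ := exists_gt (0 : R)
        exact ⟨d, hd, by simp⟩
      | insert i J _ ih =>
        obtain ⟨d, hd, h⟩ := ih
        refine ⟨min d (e i), lt_min hd (he i), ?_⟩
        intro j hj
        rcases Finset.mem_insert.1 hj with rfl | hj
        · exact min_le_right _ _
        · exact (min_le_left _ _).trans (h j hj)
    obtain ⟨d, hd, h⟩ := key Finset.univ
    refine ⟨d, hd, fun y hy => hS ?_⟩
    intro i _
    have h1 := h i (Finset.mem_univ i)
    have h2 := hy i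
    exact hte i _ (by grind) (by grind)
  · rintro ⟨e, he, h⟩
    have : Set.pi Set.univ (fun i => Set.Ioo (a i - e) (a i + e)) ∈ 𝓝 a := by
      refine set_pi_mem_nhds Set.finite_univ fun i _ => ?_
      exact Ioo_mem_nhds (by grind) (by grind)
    refine Filter.mem_of_superset this fun y hy => h y fun i => ?_
    exact hy i (Set.mem_univ i)

theorem exists_glb (B : Base L R) (hDC : DCProp L R) {S : Set R}
    (hS : DefP L (fun v : Fin 1 → R => v 0 ∈ S)) (hne : S.Nonempty) (hb : BddBelow S) :
    ∃ a, IsGLB S a := by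
  have : DefP L (fun v : Fin 1 → R => v 0 ∈ lowerBounds S) := by
    refine DefP.congr (P := fun v => ∀ y, y ∈ S → v 0 ≤ y) ?_ (fun v => Iff.rfl)
    refine DefP.all (DefP.imp (hS.subst1 (Q := fun y => y ∈ S) (DFun.proj _)) ?_)
    exact B.le' (DFun.proj _) (DFun.proj _)
  obtain ⟨a, ha⟩ := hDC _ this hb (hne.mono fun x hx y hy => hy hx)
  exact ⟨a, isLUB_lowerBounds.1 ha⟩

/-- Finite sets miss a punctured neighbourhood. -/
theorem LocFin.isolate {D : Set R} (hD : LocFin D) (a : R) :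
    ∃ e, 0 < e ∧ ∀ y ∈ D, a - e < y → y < a + e → y = a := by
  obtain ⟨U, hU, haU, hfin⟩ := hD a
  have h2 : (((D ∩ U) \ {a}))ᶜ ∈ 𝓝 a :=
    (hfin.subset Set.sdiff_subset).isClosed.isOpen_compl.mem_nhds (by simp)
  obtain ⟨e, he, h⟩ := mem_nhds_iff1.1 (Filter.inter_mem h2 (hU.mem_nhds haU))
  refine ⟨e, he, fun y hy h1 h3 => ?_⟩
  by_contra hne
  have := h y h1 h3
  exact this.1 ⟨⟨hy, this.2⟩, hne⟩

theorem exists_next (B : Base L R) (hDC : DCProp L R) {D : Set R}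
    (hdef : DefP L (fun v : Fin 1 → R => v 0 ∈ D)) (hD : LocFin D) {y q : R}
    (hne : (D ∩ Set.Ioc y q).Nonempty) : ∃ z ∈ D, y < z ∧ z ≤ q ∧ ∀ w ∈ D, y < w → z ≤ w := by
  have hd : DefP L (fun v : Fin 1 → R => v 0 ∈ D ∩ Set.Ioc y q) :=
    DefP.and hdef (DefP.and (B.lt' (DFun.const _) (DFun.proj _)) (B.le' (DFun.proj _) (DFun.const _)))
  obtain ⟨z, hz⟩ := exists_glb B hDC hd hne ⟨y, fun w hw => hw.2.1.le⟩
  obtain ⟨e, he, hiso⟩ := LocFin.isolate hD z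
  obtain ⟨w, hw, hwz⟩ := (isGLB_lt_iff hz).1 (show z < z + e by grind)
  have hzw : z ≤ w := hz.1 hw
  have : w = z := hiso w hw.1 (by grind) hwz
  subst this
  refine ⟨w, hw.1, hw.2.1, hw.2.2, fun u hu hyu => ?_⟩
  rcases le_total u q with h | h
  · exact hz.1 ⟨hu, hyu, h⟩
  · exact hw.2.2.trans h

theorem exists_prev (B : Base L R) (hDC : DCProp L R) {D : Set R}
    (hdef : DefP L (fun v : Fin 1 → R => v 0 ∈ D)) (hD : LocFin D) {y p : R}
    (hne : (D ∩ Set.Ico p y).Nonempty) : ∃ z ∈ D, z < y ∧ p ≤ z ∧ ∀ w ∈ D, w < y → w ≤ z := by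
  have hd : DefP L (fun v : Fin 1 → R => v 0 ∈ D ∩ Set.Ico p y) :=
    DefP.and hdef (DefP.and (B.le' (DFun.const _) (DFun.proj _)) (B.lt' (DFun.proj _) (DFun.const _)))
  obtain ⟨z, hz⟩ := hDC _ hd hne ⟨y, fun w hw => hw.2.2.le⟩
  obtain ⟨e, he, hiso⟩ := LocFin.isolate hD z
  obtain ⟨w, hw, hwz⟩ := (lt_isLUB_iff hz).1 (show z - e < z by grind)
  have hzw : w ≤ z := hz.1 hw
  have : w = z := hiso w hw.1 hwz (by grind)
  subst this
  refine ⟨w, hw.1, hw.2.2, hw.2.1, fun u hu hyu => ?_⟩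
  rcases le_total p u with h | h
  · exact hz.1 ⟨hu, h, hyu⟩
  · exact h.trans hw.2.1

theorem fin_right (B : Base L R) (hDC : DCProp L R) {D : Set R}
    (hdef : DefP L (fun v : Fin 1 → R => v 0 ∈ D)) (hD : LocFin D) {p q₀ q : R} {N : ℕ}
    (hp : p ≤ q₀) (hq : q₀ ≤ q) (h0 : (D ∩ Set.Icc p q₀).Finite)
    (hN : ∀ y, q₀ ≤ y → y ≤ q → (D ∩ Set.Icc p y).Infinite ∨ (D ∩ Set.Icc p y).ncard ≤ N) :
    (D ∩ Set.Icc p q).Finite := by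
  by_contra hinf
  have key : ∀ k : ℕ, ∃ y, q₀ ≤ y ∧ y ≤ q ∧ (D ∩ Set.Icc p y).Finite ∧
      k ≤ (D ∩ Set.Icc p y).ncard := by
    intro k
    induction k with
    | zero => exact ⟨q₀, le_rfl, hq, h0, Nat.zero_le _⟩
    | succ k ih =>
      obtain ⟨y, h1, h2, h3, h4⟩ := ih
      have hne : (D ∩ Set.Ioc y q).Nonempty := by
        by_contra hem
        refine hinf (h3.subset fun w hw => ⟨hw.1, hw.2.1, ?_⟩)
        by_contra hlt
        exact hem ⟨w, hw.1, not_le.1 hlt, hw.2.2⟩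
      obtain ⟨z, hz, hyz, hzq, hmin⟩ := exists_next B hDC hdef hD hne
      have heq : D ∩ Set.Icc p z = insert z (D ∩ Set.Icc p y) := by
        ext w
        simp only [Set.mem_inter_iff, Set.mem_Icc, Set.mem_insert_iff]
        constructor
        · rintro ⟨hw, hpw, hwz⟩
          by_cases hwy : w ≤ y
          · exact Or.inr ⟨hw, hpw, hwy⟩
          · exact Or.inl (le_antisymm hwz (hmin w hw (not_le.1 hwy)))
        · rintro (rfl | ⟨hw, hpw, hwy⟩)
          · exact ⟨hz, by order, le_rfl⟩
          · exact ⟨hw, hpw, by order⟩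
      refine ⟨z, by order, hzq, ?_, ?_⟩
      · rw [heq]; exact h3.insert z
      · rw [heq, Set.ncard_insert_of_notMem (fun h => absurd h.2.2 (not_le.2 hyz)) h3]
        omega
  obtain ⟨y, h1, h2, h3, h4⟩ := key (N + 1)
  rcases hN y h1 h2 with h | h
  · exact h h3
  · omega

theorem fin_left (B : Base L R) (hDC : DCProp L R) {D : Set R}
    (hdef : DefP L (fun v : Fin 1 → R => v 0 ∈ D)) (hD : LocFin D) {p p₀ q : R} {N : ℕ}
    (hp : p ≤ p₀) (hq : p₀ ≤ q) (h0 : (D ∩ Set.Icc p₀ q).Finite)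
    (hN : ∀ y, p ≤ y → y ≤ p₀ → (D ∩ Set.Icc y q).Infinite ∨ (D ∩ Set.Icc y q).ncard ≤ N) :
    (D ∩ Set.Icc p q).Finite := by
  by_contra hinf
  have key : ∀ k : ℕ, ∃ y, p ≤ y ∧ y ≤ p₀ ∧ (D ∩ Set.Icc y q).Finite ∧
      k ≤ (D ∩ Set.Icc y q).ncard := by
    intro k
    induction k with
    | zero => exact ⟨p₀, hp, le_rfl, h0, Nat.zero_le _⟩
    | succ k ih =>
      obtain ⟨y, h1, h2, h3, h4⟩ := ih
      have hne : (D ∩ Set.Ico p y).Nonempty := by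
        by_contra hem
        refine hinf (h3.subset fun w hw => ⟨hw.1, ?_, hw.2.2⟩)
        by_contra hlt
        exact hem ⟨w, hw.1, hw.2.1, not_le.1 hlt⟩
      obtain ⟨z, hz, hyz, hzq, hmin⟩ := exists_prev B hDC hdef hD hne
      have heq : D ∩ Set.Icc z q = insert z (D ∩ Set.Icc y q) := by
        ext w
        simp only [Set.mem_inter_iff, Set.mem_Icc, Set.mem_insert_iff]
        constructor
        · rintro ⟨hw, hpw, hwz⟩
          by_cases hwy : y ≤ w
          · exact Or.inr ⟨hw, hwy, hwz⟩
          · exact Or.inl (le_antisymm (hmin w hw (not_le.1 hwy)) hpw)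
        · rintro (rfl | ⟨hw, hpw, hwy⟩)
          · exact ⟨hz, le_rfl, by order⟩
          · exact ⟨hw, by order, hwy⟩
      refine ⟨z, hzq, by order, ?_, ?_⟩
      · rw [heq]; exact h3.insert z
      · rw [heq, Set.ncard_insert_of_notMem (fun h => absurd h.2.1 (not_le.2 hyz)) h3]
        omega
  obtain ⟨y, h1, h2, h3, h4⟩ := key (N + 1)
  rcases hN y h1 h2 with h | h
  · exact h h3
  · omega

theorem fin_both (B : Base L R) (hDC : DCProp L R) {D : Set R}
    (hdef : DefP L (fun v : Fin 1 → R => v 0 ∈ D)) (hD : LocFin D) {a p q : R} {N : ℕ}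
    (hpa : p < a) (haq : a < q)
    (hN : ∀ p' q', p ≤ p' → p' < a → a < q' → q' ≤ q →
      (D ∩ Set.Icc p' q').Infinite ∨ (D ∩ Set.Icc p' q').ncard ≤ N) :
    (D ∩ Set.Icc p q).Finite := by
  obtain ⟨e, he, hiso⟩ := LocFin.isolate hD a
  obtain ⟨p₀, hp1, hp2⟩ := exists_between (show max p (a - e) < a from max_lt hpa (by grind))
  obtain ⟨q₀, hq1, hq2⟩ := exists_between (show a < min q (a + e) from lt_min haq (by grind))
  have h0 : (D ∩ Set.Icc p₀ q₀).Finite := by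
    refine (Set.finite_singleton a).subset fun y hy => ?_
    obtain ⟨hy, h1, h2⟩ := hy
    exact hiso y hy (by grind) (by grind)
  have h1 : (D ∩ Set.Icc p₀ q).Finite :=
    fin_right B hDC hdef hD (by grind) (by grind) h0 fun y h1 h2 =>
      hN _ _ (by grind) hp2 (by grind) h2
  exact fin_left B hDC hdef hD (by grind) (by grind) h1 fun y h1 h2 =>
      hN _ _ h1 (by grind) haq le_rfl

theorem locFin_iUnion (B : Base L R) (hDC : DCProp L R) (hLUF : LUF2 L R) {Z : R → Set R}
    (hdef : DefP L (fun v : Fin 2 → R => v 1 ∈ Z (v 0)))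
    (hZ : ∀ t, 0 < t → LocFin (Z t))
    (hanti : ∀ t t', 0 < t → t ≤ t' → Z t' ⊆ Z t) :
    LocFin {y | ∃ t, 0 < t ∧ y ∈ Z t} := by
  intro a
  have hdef' : IsDefinable L {v : Fin (1 + 1) → R | v 1 ∈ Z (v 0)} := hdef
  obtain ⟨N, -, p, q, ha, U, ⟨c, d, rfl⟩, hb, h⟩ := hLUF 1 _ hdef' a (fun _ => 0)
  rw [interior_Icc] at ha
  have hfib : ∀ x : Fin 1 → R, fiber1 {v : Fin (1 + 1) → R | v 1 ∈ Z (v 0)} x = Z (x 0) := by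
    intro x
    ext y
    change (Fin.snoc x y : Fin 2 → R) 1 ∈ Z ((Fin.snoc x y : Fin 2 → R) 0) ↔ _
    have e1 : (Fin.snoc x y : Fin 2 → R) 1 = y := Fin.snoc_last (α := fun _ => R) y x
    have e0 : (Fin.snoc x y : Fin 2 → R) 0 = x 0 := Fin.snoc_castSucc (α := fun _ => R) y x 0
    rw [e1, e0]
  have hd0 : 0 < d 0 := (hb 0).2
  have hc0 : c 0 < 0 := (hb 0).1
  have hfin : ∀ t, 0 < t → t < d 0 → (Z t ∩ Set.Icc p q).Finite ∧ (Z t ∩ Set.Icc p q).ncard ≤ N := by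
    intro t ht htd
    have hN : ∀ p' q', p ≤ p' → p' < a → a < q' → q' ≤ q →
      (Z t ∩ Set.Icc p' q').Infinite ∨ (Z t ∩ Set.Icc p' q').ncard ≤ N := by
      intro p' q' h1 h2 h3 h4
      have := h (fun _ => t) (by
        intro i
        have : i = 0 := Subsingleton.elim _ _
        subst this
        exact ⟨hc0.trans ht, htd⟩) p' q' (by rw [interior_Icc]; exact ⟨h2, h3⟩)
        (Set.Icc_subset_Icc h1 h4)
      rwa [hfib] at this
    have hD : DefP L (fun v : Fin 1 → R => v 0 ∈ Z t) :=
      hdef.subst2 (Q := fun t y => y ∈ Z t) (DFun.const t) (DFun.proj 0)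
    have hf := fin_both B hDC hD (hZ t ht) ha.1 ha.2 hN
    refine ⟨hf, ?_⟩
    rcases hN p q le_rfl ha.1 ha.2 le_rfl with h | h
    · exact absurd hf h
    · exact h
  refine ⟨Set.Ioo p q, isOpen_Ioo, ha, ?_⟩
  by_contra hinf
  obtain ⟨s, hs, hcard⟩ := Set.Infinite.exists_subset_card_eq hinf (N + 1)
  have key : ∀ s : Finset R, (∀ y ∈ s, ∃ t, 0 < t ∧ y ∈ Z t) →
      ∃ t, 0 < t ∧ t < d 0 ∧ ∀ y ∈ s, y ∈ Z t := by
    intro s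
    induction s using Finset.induction_on with
    | empty =>
      intro _
      obtain ⟨t, h1, h2⟩ := exists_between hd0
      exact ⟨t, h1, h2, by simp⟩
    | insert i J _ ih =>
      intro hs
      obtain ⟨t, h1, h2, h3⟩ := ih fun y hy => hs y (Finset.mem_insert_of_mem hy)
      obtain ⟨t', h1', h2'⟩ := hs i (Finset.mem_insert_self i J)
      refine ⟨min t t', lt_min h1 h1', (min_le_left _ _).trans_lt h2, fun y hy => ?_⟩
      rcases Finset.mem_insert.1 hy with rfl | hy
      · exact hanti _ _ (lt_min h1 h1') (min_le_right _ _) h2'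
      · exact hanti _ _ (lt_min h1 h1') (min_le_left _ _) (h3 y hy)
  obtain ⟨t, ht, htd, hts⟩ := key s fun y hy => (hs hy).1
  have h1 : (s : Set R) ⊆ Z t ∩ Set.Icc p q := fun y hy =>
    ⟨hts y hy, Set.Ioo_subset_Icc_self (hs hy).2⟩
  have h2 := Set.ncard_le_ncard h1 (hfin t ht htd).1
  rw [Set.ncard_coe_finset, hcard] at h2
  have := (hfin t ht htd).2
  omega

/-- A `t`-separated set is locally finite. -/
theorem locFin_of_sep {D : Set R} {t : R} (ht : 0 < t)
    (h : ∀ y ∈ D, ∀ z ∈ D, y < z → y + t ≤ z) : LocFin D := by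
  intro x
  obtain ⟨d, hd, hdt⟩ := exists_double t ht
  refine ⟨Set.Ioo (x - d) (x + d), isOpen_Ioo, ⟨by grind, by grind⟩, ?_⟩
  refine Set.Subsingleton.finite ?_
  rintro y ⟨hy, hy1, hy2⟩ z ⟨hz, hz1, hz2⟩
  rcases lt_trichotomy y z with hlt | heq | hlt
  · have := h y hy z hz hlt; grind
  · exact heq
  · have := h z hz y hy hlt; grind

theorem locFin_of_closed (B : Base L R) (hDC : DCProp L R) (hLUF : LUF2 L R) {C : Set R}
    (hdef : DefP L (fun v : Fin 1 → R => v 0 ∈ C)) (hcl : IsClosed C) (hint : interior C = ∅) :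
    LocFin C := by
  have hE := locFin_iUnion B hDC hLUF (Z := fun t => {y | y ∈ C ∧ ∀ z, y < z → z < y + t → z ∉ C})
    (by
      refine DefP.and (hdef.subst1 (Q := fun y => y ∈ C) (DFun.proj _)) (DefP.all ?_)
      refine DefP.imp (B.lt' (DFun.proj _) (DFun.proj _)) (DefP.imp ?_ (DefP.not ?_))
      · exact B.lt' (DFun.proj _) (B.add' (DFun.proj _) (DFun.proj _))
      · exact (hdef.subst1 (Q := fun y => y ∈ C) (DFun.proj _)))
    (by
      intro t ht
      refine locFin_of_sep ht ?_
      rintro y ⟨hy, hy2⟩ z ⟨hz, hz2⟩ hyz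
      by_contra hlt
      exact hy2 z hyz (not_le.1 hlt) hz)
    (by
      rintro t t' ht htt y ⟨hy, hy2⟩
      exact ⟨hy, fun z h1 h2 => hy2 z h1 (by grind)⟩)
  intro a
  obtain ⟨U, hU, haU, hfin⟩ := hE a
  obtain ⟨p, q, ⟨hpa, haq⟩, hpq⟩ := mem_nhds_iff_exists_Ioo_subset.1 (hU.mem_nhds haU)
  set E : Set R := {y | ∃ t, 0 < t ∧ y ∈ {y | y ∈ C ∧ ∀ z, y < z → z < y + t → z ∉ C}} with hEdef
  refine ⟨Set.Ioo p q, isOpen_Ioo, ⟨hpa, haq⟩, ?_⟩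
  have hlt : ∀ u ∈ C ∩ Set.Ioo p q, ∀ v ∈ C ∩ Set.Ioo p q, u < v →
      ∃ e ∈ E ∩ U, u ≤ e ∧ e < v := by
    rintro u ⟨hu, hu1, hu2⟩ v ⟨hv, hv1, hv2⟩ huv
    have : ¬ Set.Ioo u v ⊆ C := by
      intro hsub
      obtain ⟨w, hw⟩ := exists_between huv
      have : w ∈ interior C := interior_mono hsub (by rwa [isOpen_Ioo.interior_eq])
      rw [hint] at this
      exact this
    obtain ⟨w, ⟨hw1, hw2⟩, hwC⟩ := Set.not_subset.1 this
    have hd : DefP L (fun x : Fin 1 → R => x 0 ∈ C ∩ Set.Icc u w) :=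
      DefP.and hdef (DefP.and (B.le' (DFun.const _) (DFun.proj _)) (B.le' (DFun.proj _) (DFun.const _)))
    have hne : (C ∩ Set.Icc u w).Nonempty := ⟨u, hu, le_rfl, hw1.le⟩
    obtain ⟨e, he⟩ := hDC _ hd hne ⟨w, fun x hx => hx.2.2⟩
    have heC := (hcl.inter isClosed_Icc).isLUB_mem he hne
    have hew : e < w := lt_of_le_of_ne heC.2.2 fun h => hwC (h ▸ heC.1)
    refine ⟨e, ⟨⟨w - e, by grind, heC.1, ?_⟩, hpq ⟨?_, ?_⟩⟩, heC.2.1, ?_⟩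
    · intro z h1 h2 hz
      have : z ≤ e := he.1 ⟨hz, heC.2.1.trans h1.le, by grind⟩
      order
    · have := heC.2.1; order
    · order
    · order
  refine Set.Finite.of_injOn (f := fun u => {e | e ∈ E ∩ U ∧ e < u}) (t := 𝒫 (E ∩ U)) ?_ ?_
    hfin.finite_subsets
  · intro u _ e he
    exact he.1
  · intro u hu v hv huv
    rcases lt_trichotomy u v with h | h | h
    · obtain ⟨e, he, h1, h2⟩ := hlt u hu v hv h
      have : e ∈ {e | e ∈ E ∩ U ∧ e < v} := ⟨he, h2⟩
      have huv' : {e | e ∈ E ∩ U ∧ e < u} = {e | e ∈ E ∩ U ∧ e < v} := huv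
      rw [← huv'] at this
      exact absurd this.2 (not_lt.2 h1)
    · exact h
    · obtain ⟨e, he, h1, h2⟩ := hlt v hv u hu h
      have : e ∈ {e | e ∈ E ∩ U ∧ e < u} := ⟨he, h2⟩
      have huv' : {e | e ∈ E ∩ U ∧ e < u} = {e | e ∈ E ∩ U ∧ e < v} := huv
      rw [huv'] at this
      exact absurd this.2 (not_lt.2 h1)

/-- Increasing definable unions of locally finite sets are locally finite. -/
theorem locFin_mono_union (B : Base L R) (hDC : DCProp L R) (hLUF : LUF2 L R) {Y : R → Set R}
    (hdef : DefP L (fun v : Fin 2 → R => v 1 ∈ Y (v 0)))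
    (hY : ∀ r, 0 < r → LocFin (Y r))
    (hmono : ∀ r r', 0 < r → r ≤ r' → Y r ⊆ Y r') :
    LocFin {y | ∃ r, 0 < r ∧ y ∈ Y r} := by
  have hE := locFin_iUnion B hDC hLUF
    (Z := fun t => {y | ∃ r, 0 < r ∧ y ∈ Y r ∧
      ∀ z, z ∈ Y r → z = y ∨ z + t ≤ y ∨ y + t ≤ z})
    (by
      refine DefP.ex (DefP.and (B.lt' (DFun.const _) (DFun.proj _)) (DefP.and
        (hdef.subst2 (Q := fun t y => y ∈ Y t) (DFun.proj _) (DFun.proj _)) (DefP.all ?_)))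
      refine DefP.imp (hdef.subst2 (Q := fun t y => y ∈ Y t) (DFun.proj _) (DFun.proj _)) ?_
      refine DefP.or (DefP.eq (DFun.proj _) (DFun.proj _)) (DefP.or ?_ ?_)
      · exact B.le' (B.add' (DFun.proj _) (DFun.proj _)) (DFun.proj _)
      · exact B.le' (B.add' (DFun.proj _) (DFun.proj _)) (DFun.proj _))
    (by
      intro t ht
      refine locFin_of_sep ht ?_
      rintro y ⟨r, hr, hy, hy2⟩ z ⟨r', hr', hz, hz2⟩ hyz
      rcases le_total r r' with h | h
      · have := hz2 y (hmono _ _ hr h hy)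
        grind
      · have := hy2 z (hmono _ _ hr' h hz)
        grind)
    (by
      rintro t t' ht htt y ⟨r, hr, hy, hy2⟩
      refine ⟨r, hr, hy, fun z hz => ?_⟩
      have := hy2 z hz
      grind)
  intro a
  obtain ⟨U, hU, haU, hfin⟩ := hE a
  refine ⟨U, hU, haU, hfin.subset ?_⟩
  rintro y ⟨⟨r, hr, hy⟩, hyU⟩
  obtain ⟨e, he, hiso⟩ := LocFin.isolate (hY r hr) y
  refine ⟨⟨e, he, r, hr, hy, fun z hz => ?_⟩, hyU⟩
  have := hiso z hz
  grind

theorem oneDim (B : Base L R) (hDC : DCProp L R) (hLUF : LUF2 L R) {A : R → R → Set R}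
    (hdef : DefP L (fun v : Fin 3 → R => v 2 ∈ A (v 0) (v 1)))
    (hcl : ∀ r s, 0 < r → 0 < s → IsClosed (A r s))
    (hr : ∀ r r' s, 0 < r → 0 < s → r ≤ r' → A r s ⊆ A r' s)
    (hs : ∀ r s s', 0 < r → 0 < s → s ≤ s' → A r s' ⊆ A r s)
    (hint : ∀ r s, 0 < r → 0 < s → interior (A r s) = ∅) :
    LocFin {y | ∃ s, 0 < s ∧ ∃ r, 0 < r ∧ y ∈ A r s} := by
  refine locFin_iUnion B hDC hLUF (Z := fun s => {y | ∃ r, 0 < r ∧ y ∈ A r s}) ?_ ?_ ?_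
  · refine DefP.ex (DefP.and (B.lt' (DFun.const _) (DFun.proj _)) ?_)
    exact hdef.subst3 (Q := fun r s y => y ∈ A r s) (DFun.proj _) (DFun.proj _) (DFun.proj _)
  · intro s hs0
    refine locFin_mono_union B hDC hLUF (Y := fun r => A r s) ?_ ?_ fun r r' h1 h2 => hr _ _ _ h1 hs0 h2
    · exact hdef.subst3 (Q := fun r s y => y ∈ A r s) (DFun.proj _) (DFun.const _) (DFun.proj _)
    · intro r hr0
      refine locFin_of_closed B hDC hLUF ?_ (hcl r s hr0 hs0) (hint r s hr0 hs0)
      exact hdef.subst3 (Q := fun r s y => y ∈ A r s) (DFun.const _) (DFun.const _) (DFun.proj _)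
  · rintro t t' ht htt y ⟨r, h0, hy⟩
    exact ⟨r, h0, hs _ _ _ h0 ht htt hy⟩

theorem LocFin.interior_eq {D : Set R} (hD : LocFin D) : interior D = ∅ := by
  by_contra hne
  obtain ⟨a, ha⟩ := Set.nonempty_iff_ne_empty.2 hne
  obtain ⟨e, he, h⟩ := mem_nhds_iff1.1 (mem_interior_iff_mem_nhds.1 ha)
  obtain ⟨e', he', hiso⟩ := LocFin.isolate hD a
  obtain ⟨y, hy1, hy2⟩ := exists_between (show a < a + min e e' by grind)
  have := hiso y (h y (by grind) (by grind)) (by grind) (by grind)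
  order

end OneDim
section NDim

variable {R : Type*} {L : FirstOrder.Language} [L.Structure R] [LinearOrder R] [AddCommGroup R]
  [IsOrderedAddMonoid R] [DenselyOrdered R] [Nontrivial R] [TopologicalSpace R] [OrderTopology R]

theorem heineBorel (B : Base L R) (hDC : DCProp L R) {G : R → R → Prop}
    (hdef : DefP L (fun v : Fin 2 → R => G (v 0) (v 1)))
    (hanti : ∀ e e' y, 0 < e → e ≤ e' → G e' y → G e y) {c d : R}
    (hloc : ∀ y, c ≤ y → y ≤ d → ∃ e, 0 < e ∧ ∃ δ, 0 < δ ∧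
      ∀ y', y - δ < y' → y' < y + δ → G e y') :
    ∃ e, 0 < e ∧ ∀ y, c ≤ y → y ≤ d → G e y := by
  rcases lt_or_ge d c with hdc | hcd
  · obtain ⟨e, he⟩ := exists_gt (0 : R)
    exact ⟨e, he, fun y h1 h2 => by order⟩
  let S : Set R := {y | y ≤ d ∧ ∃ e, 0 < e ∧ ∀ y', c ≤ y' → y' ≤ y → G e y'}
  have hS : DefP L (fun v : Fin 1 → R => v 0 ∈ S) := by
    refine DefP.and (B.le' (DFun.proj _) (DFun.const _)) (DefP.ex (DefP.and
      (B.lt' (DFun.const _) (DFun.proj _)) (DefP.all (DefP.imp (B.le' (DFun.const _) (DFun.proj _))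
        (DefP.imp (B.le' (DFun.proj _) (DFun.proj _)) ?_)))))
    exact hdef.subst2 (Q := G) (DFun.proj _) (DFun.proj _)
  have hcS : c ∈ S := by
    obtain ⟨e, he, δ, hδ, h⟩ := hloc c le_rfl hcd
    refine ⟨hcd, e, he, fun y' h1 h2 => h y' (by grind) (by grind)⟩
  obtain ⟨σ, hσ⟩ := hDC S hS ⟨c, hcS⟩ ⟨d, fun y hy => hy.1⟩
  have hcσ : c ≤ σ := hσ.1 hcS
  have hσd : σ ≤ d := hσ.2 fun y hy => hy.1
  obtain ⟨e, he, δ, hδ, h⟩ := hloc σ hcσ hσd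
  obtain ⟨y, ⟨hyd, e', he', hy⟩, hlt⟩ := (lt_isLUB_iff hσ).1 (show σ - δ < σ by grind)
  have key : ∀ y', c ≤ y' → y' < σ + δ → G (min e e') y' := by
    intro y' h1 h2
    rcases le_or_gt y' y with h3 | h3
    · exact hanti _ _ _ (lt_min he he') (min_le_right _ _) (hy y' h1 h3)
    · exact hanti _ _ _ (lt_min he he') (min_le_left _ _) (h y' (by grind) h2)
  refine ⟨min e e', lt_min he he', fun y' h1 h2 => key y' h1 ?_⟩
  rcases lt_or_eq_of_le hσd with h3 | h3
  · exfalso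
    obtain ⟨y1, h4, h5⟩ := exists_between (show σ < min d (σ + δ) by grind)
    have : y1 ∈ S := ⟨by grind, min e e', lt_min he he', fun z hz1 hz2 => key z hz1 (by grind)⟩
    have := hσ.1 this
    order
  · grind

theorem closed_proj (B : Base L R) (hDC : DCProp L R) {n : ℕ} {W : (Fin n → R) → R → Prop}
    (hdef : DefP L (fun v : Fin n ⊕ Unit → R => W (fun i => v (Sum.inl i)) (v (Sum.inr ()))))
    (hcl : IsClosed {w : (Fin n → R) × R | W w.1 w.2}) (c d : R) :
    IsClosed {x | ∃ y, c ≤ y ∧ y ≤ d ∧ W x y} := by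
  rw [← isOpen_compl_iff, isOpen_iff_mem_nhds]
  intro x hx
  rw [mem_nhds_iffN]
  have := heineBorel B hDC
    (G := fun e y => ∀ x' : Fin n → R, (∀ i, x i - e < x' i ∧ x' i < x i + e) → ¬ W x' y)
    (by
      refine DefP.allN (DefP.imp (DefP.allFin fun i => DefP.and ?_ ?_) (DefP.not ?_))
      · exact B.lt' (B.sub' (DFun.const _) (DFun.proj _)) (DFun.proj _)
      · exact B.lt' (DFun.proj _) (B.add' (DFun.const _) (DFun.proj _))
      · refine hdef.subst (g := fun (v : Fin 2 ⊕ Fin n → R) =>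
          Sum.elim (fun i => v (Sum.inr i)) (fun _ => v (Sum.inl 1))) ?_
        rintro (i | i)
        · exact DFun.proj _
        · exact DFun.proj _)
    (by
      intro e e' y he hee h x' hx'
      refine h x' fun i => ?_
      have := hx' i
      grind)
    (c := c) (d := d)
    (by
      intro y hcy hyd
      have hxy : ¬ W x y := fun h => hx ⟨y, hcy, hyd, h⟩
      have hn : {w : (Fin n → R) × R | W w.1 w.2}ᶜ ∈ 𝓝 (x, y) := hcl.isOpen_compl.mem_nhds hxy
      rw [nhds_prod_eq, Filter.mem_prod_iff] at hn
      obtain ⟨U, hU, V, hV, hUV⟩ := hn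
      obtain ⟨e, he, h1⟩ := mem_nhds_iffN.1 hU
      obtain ⟨δ, hδ, h2⟩ := mem_nhds_iff1.1 hV
      refine ⟨e, he, δ, hδ, fun y' hy1 hy2 x' hx' => ?_⟩
      exact hUV (Set.mk_mem_prod (h1 x' hx') (h2 y' hy1 hy2)))
  obtain ⟨e, he, h⟩ := this
  refine ⟨e, he, fun x' hx' => ?_⟩
  rintro ⟨y, h1, h2, h3⟩
  exact h y h1 h2 x' hx' h3

/-- `D_Σ`-families, as families of sets. -/
structure Fam (L : FirstOrder.Language) [L.Structure R] {n : ℕ}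
    (X : R → R → Set (Fin n → R)) : Prop where
  defn : DefP L (fun v : Fin 2 ⊕ Fin n → R =>
    (fun i => v (Sum.inr i)) ∈ X (v (Sum.inl 0)) (v (Sum.inl 1)))
  cl : ∀ r s, 0 < r → 0 < s → IsClosed (X r s)
  bdd : ∀ r s, 0 < r → 0 < s → BddSet (X r s)
  mr : ∀ r r' s, 0 < r → 0 < s → r ≤ r' → X r s ⊆ X r' s
  ms : ∀ r s s', 0 < r → 0 < s → s ≤ s' → X r s' ⊆ X r s

theorem Fam.mem {n : ℕ} {X : R → R → Set (Fin n → R)} (hX : Fam L X) {α : Type}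
    {f g : (α → R) → R} {h : (α → R) → Fin n → R} (hf : DFun L f) (hg : DFun L g)
    (hh : ∀ i, DFun L (fun v => h v i)) : DefP L (fun v => h v ∈ X (f v) (g v)) := by
  refine hX.defn.subst (g := fun v => Sum.elim ![f v, g v] (h v)) ?_
  rintro (i | i)
  · fin_cases i
    · exact hf
    · exact hg
  · exact hh i

theorem dfun_snoc {n : ℕ} {α : Type} {h : (α → R) → Fin n → R} {f : (α → R) → R}
    (hh : ∀ i, DFun L (fun v => h v i)) (hf : DFun L f) (i : Fin (n + 1)) :
    DFun L (fun v => (Fin.snoc (h v) (f v) : Fin (n + 1) → R) i) := by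
  refine Fin.lastCases ?_ (fun j => ?_) i
  · simpa using hf
  · simpa using hh j

theorem Fam.slab_def (B : Base L R) {n : ℕ} {X : R → R → Set (Fin (n + 1) → R)} (hX : Fam L X)
    {α : Type} {f g k : (α → R) → R} {h : (α → R) → Fin n → R}
    (hf : DFun L f) (hg : DFun L g) (hk : DFun L k)
    (hh : ∀ i, DFun L (fun v => h v i)) :
    DefP L (fun v => ∀ z, k v ≤ z → z ≤ k v + g v →
      (Fin.snoc (h v) z : Fin (n + 1) → R) ∈ X (f v) (g v)) := by
  have h0 : DefP L (fun v : Fin 3 ⊕ Fin n → R => ∀ z, v (Sum.inl 2) ≤ z →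
      z ≤ v (Sum.inl 2) + v (Sum.inl 1) →
      (Fin.snoc (fun i => v (Sum.inr i)) z : Fin (n + 1) → R)
        ∈ X (v (Sum.inl 0)) (v (Sum.inl 1))) := by
    refine DefP.all (DefP.imp (B.le' (DFun.proj _) (DFun.proj _)) (DefP.imp
      (B.le' (DFun.proj _) (B.add' (DFun.proj _) (DFun.proj _))) ?_))
    refine hX.mem (DFun.proj _) (DFun.proj _) (dfun_snoc (fun i => DFun.proj _) (DFun.proj _))
  refine h0.subst (g := fun v => Sum.elim ![f v, g v, k v] (h v)) ?_
  rintro (i | i)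
  · fin_cases i
    · exact hf
    · exact hg
    · exact hk
  · exact hh i

theorem slab_closed {n : ℕ} {A : Set (Fin (n + 1) → R)} (hA : IsClosed A) (s : R) :
    IsClosed {w : (Fin n → R) × R | ∀ z, w.2 ≤ z → z ≤ w.2 + s →
      (Fin.snoc w.1 z : Fin (n + 1) → R) ∈ A} := by
  have : {w : (Fin n → R) × R | ∀ z, w.2 ≤ z → z ≤ w.2 + s →
      (Fin.snoc w.1 z : Fin (n + 1) → R) ∈ A} =
      ⋂ (h : R) (_ : 0 ≤ h) (_ : h ≤ s),
        (fun w : (Fin n → R) × R => (Fin.snoc w.1 (w.2 + h) : Fin (n + 1) → R)) ⁻¹' A := by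
    ext w
    simp only [Set.mem_ofPred_eq, Set.mem_iInter, Set.mem_preimage]
    constructor
    · intro hw h h1 h2
      exact hw _ (by grind) (by grind)
    · intro hw z h1 h2
      have := hw (z - w.2) (by grind) (by grind)
      rwa [add_sub_cancel] at this
  rw [this]
  refine isClosed_iInter fun h => isClosed_iInter fun _ => isClosed_iInter fun _ =>
    hA.preimage ?_
  exact Continuous.finSnoc (A := fun _ => R) continuous_fst (continuous_snd.add continuous_const)

/-- If the set of points over which `X r s` contains an interval of length `s` has interior,
then so does `X r s`. -/
theorem Fam.interior_of_slab (B : Base L R) (hDC : DCProp L R) {n : ℕ}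
    {X : R → R → Set (Fin (n + 1) → R)} (hX : Fam L X) {r s : R} (hr : 0 < r) (hs : 0 < s)
    (hint : (interior {x : Fin n → R | ∃ y, ∀ z, y ≤ z → z ≤ y + s →
      (Fin.snoc x z : Fin (n + 1) → R) ∈ X r s}).Nonempty) :
    (interior (X r s)).Nonempty := by
  obtain ⟨c, d, hcd⟩ := hX.bdd r s hr hs
  let W : (Fin n → R) → R → Prop := fun x y => ∀ z, y ≤ z → z ≤ y + s →
      (Fin.snoc x z : Fin (n + 1) → R) ∈ X r s
  have hW : ∀ x y, W x y → c ≤ y ∧ y ≤ d := by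
    intro x y h
    have := hcd _ (h y le_rfl (by grind)) (Fin.last n)
    simpa using this
  have hWdef : ∀ {α : Type} {k : (α → R) → R} {h : (α → R) → Fin n → R},
      DFun L k → (∀ i, DFun L (fun v => h v i)) → DefP L (fun v => W (h v) (k v)) := by
    intro α k h hk hh
    exact hX.slab_def B (DFun.const r) (DFun.const s) hk hh
  let H : Set R := {y₀ | ∃ x : Fin n → R, ∃ e, 0 < e ∧ ∀ x' : Fin n → R,
    (∀ i, x i - e < x' i ∧ x' i < x i + e) → ∃ y, y ≤ y₀ ∧ W x' y}
  have hHdef : DefP L (fun v : Fin 1 → R => v 0 ∈ H) := by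
    refine DefP.exN (DefP.ex (DefP.and (B.lt' (DFun.const _) (DFun.proj _)) (DefP.allN
      (DefP.imp (DefP.allFin fun i => DefP.and ?_ ?_) (DefP.ex (DefP.and ?_ ?_))))))
    · exact B.lt' (B.sub' (DFun.proj _) (DFun.proj _)) (DFun.proj _)
    · exact B.lt' (DFun.proj _) (B.add' (DFun.proj _) (DFun.proj _))
    · exact B.le' (DFun.proj _) (DFun.proj _)
    · exact hWdef (DFun.proj _) (fun i => DFun.proj _)
  have hdH : d ∈ H := by
    obtain ⟨x, hx⟩ := hint
    obtain ⟨e, he, h⟩ := mem_nhds_iffN.1 (mem_interior_iff_mem_nhds.1 hx)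
    refine ⟨x, e, he, fun x' hx' => ?_⟩
    obtain ⟨y, hy⟩ := h x' hx'
    exact ⟨y, (hW x' y hy).2, hy⟩
  have hHb : ∀ y₀ ∈ H, c ≤ y₀ := by
    rintro y₀ ⟨x, e, he, h⟩
    obtain ⟨y, hy, hWy⟩ := h x fun i => ⟨by grind, by grind⟩
    exact (hW x y hWy).1.trans hy
  obtain ⟨ys, hys⟩ := exists_glb B hDC hHdef ⟨d, hdH⟩ ⟨c, hHb⟩
  obtain ⟨δ', hδ', h2⟩ := exists_double s hs
  obtain ⟨δ, hδ, h1⟩ := exists_double δ' hδ'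
  obtain ⟨y1, ⟨x2, e2, he2, hy1⟩, hlt⟩ := (isGLB_lt_iff hys).1 (show ys < ys + δ by grind)
  have hnot : ys - δ ∉ H := fun h => by
    have := hys.1 h
    grind
  let K : Set (Fin n → R) := {x | ∃ y, c ≤ y ∧ y ≤ ys - δ ∧ W x y}
  have hK : IsClosed K :=
    closed_proj B hDC (hWdef (DFun.proj _) (fun i => DFun.proj _))
      (slab_closed (hX.cl r s hr hs) s) c (ys - δ)
  let O : Set (Fin n → R) := Set.pi Set.univ (fun i => Set.Ioo (x2 i - e2) (x2 i + e2)) \ K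
  have hO : IsOpen O := (isOpen_set_pi Set.finite_univ fun i _ => isOpen_Ioo).sdiff hK
  have hOne : O.Nonempty := by
    by_contra hem
    refine hnot ⟨x2, e2, he2, fun x' hx' => ?_⟩
    by_contra hno
    refine hem ⟨x', fun i _ => hx' i, ?_⟩
    rintro ⟨y, -, h3, h4⟩
    exact hno ⟨y, h3, h4⟩
  have hsub : ∀ x ∈ O, ∀ z, ys + δ < z → z < ys + δ + δ →
      (Fin.snoc x z : Fin (n + 1) → R) ∈ X r s := by
    rintro x ⟨hx1, hx2⟩ z hz1 hz2
    obtain ⟨y, hy, hWy⟩ := hy1 x fun i => hx1 i (Set.mem_univ i)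
    have hyl : ys - δ < y := by
      by_contra hle
      exact hx2 ⟨y, (hW x y hWy).1, not_lt.1 hle, hWy⟩
    exact hWy z (by grind) (by grind)
  obtain ⟨x3, hx3⟩ := hOne
  obtain ⟨z3, hz3, hz3'⟩ := exists_between (show ys + δ < ys + δ + δ by grind)
  let V : Set (Fin (n + 1) → R) := {v | Fin.init v ∈ O ∧ v (Fin.last n) ∈ Set.Ioo (ys + δ) (ys + δ + δ)}
  have hV : IsOpen V := by
    refine IsOpen.inter (hO.preimage ?_) (isOpen_Ioo.preimage (continuous_apply (Fin.last n)))
    exact Continuous.finInit (A := fun _ => R) continuous_id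
  refine ⟨Fin.snoc x3 z3, mem_interior.2 ⟨V, ?_, hV, ?_⟩⟩
  · rintro v ⟨h3, h4, h5⟩
    have := hsub _ h3 _ h4 h5
    rwa [Fin.snoc_init_self] at this
  · refine ⟨?_, ?_⟩
    · rw [Fin.init_snoc]; exact hx3
    · rw [Fin.snoc_last]; exact ⟨hz3, hz3'⟩

theorem Fam.main (B : Base L R) (hDC : DCProp L R) (hLUF : LUF2 L R) (n : ℕ) :
    ∀ X : R → R → Set (Fin n → R), Fam L X →
      (interior {x | ∃ s, 0 < s ∧ ∃ r, 0 < r ∧ x ∈ X r s}).Nonempty →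
      ∃ r s, 0 < r ∧ 0 < s ∧ (interior (X r s)).Nonempty := by
  induction n with
  | zero =>
    rintro X hX ⟨x, hx⟩
    obtain ⟨s, hs, r, hr, h⟩ := interior_subset hx
    refine ⟨r, s, hr, hs, x, ?_⟩
    have : X r s = Set.univ := Set.eq_univ_of_forall fun y => (Subsingleton.elim x y) ▸ h
    rw [this, interior_univ]
    trivial
  | succ n ih =>
    rintro X hX ⟨x₀, hx₀⟩
    let T : R → R → Set (Fin n → R) := fun r s =>
      {x | ∃ y, ∀ z, y ≤ z → z ≤ y + s → (Fin.snoc x z : Fin (n + 1) → R) ∈ X r s}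
    have hT : Fam L T := by
      refine ⟨?_, ?_, ?_, ?_, ?_⟩
      · refine DefP.ex ?_
        exact hX.slab_def B (DFun.proj _) (DFun.proj _) (DFun.proj _) (fun i => DFun.proj _)
      · intro r s hr hs
        obtain ⟨c, d, hcd⟩ := hX.bdd r s hr hs
        have := closed_proj B hDC (n := n) (W := fun x y => ∀ z, y ≤ z → z ≤ y + s →
          (Fin.snoc x z : Fin (n + 1) → R) ∈ X r s)
          (hX.slab_def B (DFun.const r) (DFun.const s) (DFun.proj _) (fun i => DFun.proj _))
          (slab_closed (hX.cl r s hr hs) s) c d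
        convert! this using 1
        ext x
        constructor
        · rintro ⟨y, hy⟩
          have := hcd _ (hy y le_rfl (by grind)) (Fin.last n)
          rw [Fin.snoc_last] at this
          exact ⟨y, this.1, this.2, hy⟩
        · rintro ⟨y, -, -, hy⟩
          exact ⟨y, hy⟩
      · intro r s hr hs
        obtain ⟨c, d, hcd⟩ := hX.bdd r s hr hs
        refine ⟨c, d, ?_⟩
        rintro x ⟨y, hy⟩ i
        have := hcd _ (hy y le_rfl (by grind)) i.castSucc
        rwa [Fin.snoc_castSucc] at this
      · rintro r r' s hr hs hrr x ⟨y, hy⟩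
        exact ⟨y, fun z h1 h2 => hX.mr _ _ _ hr hs hrr (hy z h1 h2)⟩
      · rintro r s s' hr hs hss x ⟨y, hy⟩
        exact ⟨y, fun z h1 h2 => hX.ms _ _ _ hr hs hss (hy z h1 (by grind))⟩
    have hTint : (interior {x | ∃ s, 0 < s ∧ ∃ r, 0 < r ∧ x ∈ T r s}).Nonempty := by
      obtain ⟨e, he, hbox⟩ := mem_nhds_iffN.1 (mem_interior_iff_mem_nhds.1 hx₀)
      refine ⟨Fin.init x₀, mem_interior_iff_mem_nhds.2 (mem_nhds_iffN.2 ⟨e, he, fun x hx => ?_⟩)⟩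
      have hnot : ¬ LocFin {y | ∃ s, 0 < s ∧ ∃ r, 0 < r ∧
          y ∈ {z | (Fin.snoc x z : Fin (n + 1) → R) ∈ X r s}} := by
        intro hL
        have h0 := LocFin.interior_eq hL
        have : x₀ (Fin.last n) ∈ interior {y | ∃ s, 0 < s ∧ ∃ r, 0 < r ∧
          y ∈ {z | (Fin.snoc x z : Fin (n + 1) → R) ∈ X r s}} := by
          refine mem_interior_iff_mem_nhds.2 (mem_nhds_iff1.2 ⟨e, he, fun z hz1 hz2 => ?_⟩)
          refine hbox (Fin.snoc x z) fun i => ?_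
          refine Fin.lastCases ?_ (fun j => ?_) i
          · rw [Fin.snoc_last]; exact ⟨hz1, hz2⟩
          · rw [Fin.snoc_castSucc]; exact hx j
        rw [h0] at this
        exact this
      have hex : ∃ r s, 0 < r ∧ 0 < s ∧
          (interior {z | (Fin.snoc x z : Fin (n + 1) → R) ∈ X r s}).Nonempty := by
        by_contra hno
        refine hnot (oneDim B hDC hLUF
          (A := fun r s => {z | (Fin.snoc x z : Fin (n + 1) → R) ∈ X r s}) ?_ ?_ ?_ ?_ ?_)
        · exact hX.mem (DFun.proj _) (DFun.proj _) (dfun_snoc (fun i => DFun.const _) (DFun.proj _))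
        · intro r s hr hs
          exact (hX.cl r s hr hs).preimage
            (Continuous.finSnoc (A := fun _ => R) continuous_const continuous_id)
        · intro r r' s hr hs hrr z hz
          exact hX.mr _ _ _ hr hs hrr hz
        · intro r s s' hr hs hss z hz
          exact hX.ms _ _ _ hr hs hss hz
        · intro r s hr hs
          by_contra hne
          exact hno ⟨r, s, hr, hs, Set.nonempty_iff_ne_empty.2 hne⟩
      obtain ⟨r, s, hr, hs, z₀, hz₀⟩ := hex
      obtain ⟨δ, hδ, hz⟩ := mem_nhds_iff1.1 (mem_interior_iff_mem_nhds.1 hz₀)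
      obtain ⟨s1, h1, h2⟩ := exists_between (show 0 < min s δ from lt_min hs hδ)
      refine ⟨s1, h1, r, hr, z₀, fun z h3 h4 => ?_⟩
      exact hX.ms r s1 s hr h1 (by grind) (hz z (by grind) (by grind))
    obtain ⟨r, s, hr, hs, h⟩ := ih T hT hTint
    exact ⟨r, s, hr, hs, hX.interior_of_slab B hDC hr hs h⟩

end NDim

end DS

/-- (Key dichotomy for `D_Σ`-families.) Let `𝓡` be a definably complete
expansion of a densely linearly ordered abelian group satisfying `LUF₂`, and let
`{X_{r,s}}_{r>0,s>0}` be a `D_Σ`-family of subsets of `R^n` with union `X`. Then either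
`X` has empty interior (and is moreover locally finite when `n = 1`), or some member
`X_{r,s}` has nonempty interior. -/
theorem dSigmaFamily_dichotomy
    {R : Type*} (L : FirstOrder.Language) [L.Structure R]
    [LinearOrder R] [DenselyOrdered R] [AddCommGroup R]
    [CovariantClass R R (· + ·) (· < ·)] [TopologicalSpace R] [OrderTopology R]
    (hlt : IsDefinable L {v : Fin 2 → R | v 0 < v 1})
    (hadd : IsDefinable L {v : Fin 3 → R | v 0 + v 1 = v 2})
    (hDC : DCProp L R) (hLUF2 : LUF2 L R)
    {n : ℕ} (F : Set (Fin (2 + n) → R)) (hF : IsDSigmaFamily L F)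
    (X : Set (Fin n → R))
    (hX : X = ⋃ (r : R) (_ : 0 < r) (s : R) (_ : 0 < s), famFiber F r s) :
    (interior X = ∅ ∧ (n = 1 → LocFin X)) ∨
      (∃ r s : R, 0 < r ∧ 0 < s ∧ (interior (famFiber F r s)).Nonempty) := by
  haveI : IsOrderedAddMonoid R := by
    refine { add_le_add_left := ?_ }
    intro a b hab c
    rcases hab.eq_or_lt with rfl | h
    · exact le_rfl
    · rw [add_comm a c, add_comm b c]
      exact (CovariantClass.elim (μ := (· + ·)) (r := (· < ·)) c h : c + a < c + b).le
  by_cases hex : ∃ r s : R, 0 < r ∧ 0 < s ∧ (interior (famFiber F r s)).Nonempty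
  · exact Or.inr hex
  left
  have hXmem : X = {x | ∃ s, 0 < s ∧ ∃ r, 0 < r ∧ x ∈ famFiber F r s} := by
    rw [hX]
    ext x
    simp only [Set.mem_iUnion, Set.mem_ofPred_eq, exists_prop]
    constructor
    · rintro ⟨r, hr, s, hs, h⟩
      exact ⟨s, hs, r, hr, h⟩
    · rintro ⟨s, hs, r, hr, h⟩
      exact ⟨r, hr, s, hs, h⟩
  by_cases hnt : ∃ r : R, 0 < r
  swap
  · have hem : X = ∅ := by
      rw [hXmem]
      refine Set.eq_empty_of_forall_notMem ?_
      rintro x ⟨s, hs, -⟩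
      exact hnt ⟨s, hs⟩
    rw [hem]
    exact ⟨interior_empty, fun _ x => ⟨Set.univ, isOpen_univ, trivial, by simp⟩⟩
  haveI : Nontrivial R := by
    obtain ⟨r, hr⟩ := hnt
    exact ⟨⟨0, r, hr.ne⟩⟩
  have B : DS.Base L R := ⟨hlt, hadd⟩
  have hFam : DS.Fam L (famFiber F) := by
    refine ⟨?_, fun r s hr hs => (hF.2.1 r s hr hs).2.1, fun r s hr hs => (hF.2.1 r s hr hs).2.2,
      hF.2.2.1, hF.2.2.2⟩
    have h0 : DS.DefP L (fun w : Fin (2 + n) → R => w ∈ F) := hF.1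
    refine h0.subst (g := fun (v : Fin 2 ⊕ Fin n → R) =>
      Fin.append ![v (Sum.inl 0), v (Sum.inl 1)] (fun i => v (Sum.inr i))) ?_
    intro i
    refine Fin.addCases (fun j => ?_) (fun j => ?_) i
    · simp only [Fin.append_left]
      fin_cases j
      · exact DS.DFun.proj _
      · exact DS.DFun.proj _
    · simp only [Fin.append_right]
      exact DS.DFun.proj _
  refine ⟨?_, ?_⟩
  · by_contra hne
    refine hex (DS.Fam.main B hDC hLUF2 n _ hFam ?_)
    rw [← hXmem]
    exact Set.nonempty_iff_ne_empty.2 hne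
  · rintro rfl
    have hc : Continuous (fun z : R => (fun _ : Fin 1 => z)) := by fun_prop
    have hcoord : ∀ v : Fin 1 → R, (fun _ : Fin 1 => v 0) = v := by
      intro v
      funext i
      rw [Subsingleton.elim i 0]
    have hL := DS.oneDim B hDC hLUF2
      (A := fun r s => {z | (fun _ : Fin 1 => z) ∈ famFiber F r s})
      (hFam.mem (DS.DFun.proj _) (DS.DFun.proj _) (fun _ => DS.DFun.proj _))
      (fun r s hr hs => (hFam.cl r s hr hs).preimage hc)
      (fun r r' s hr hs hrr z hz => hFam.mr _ _ _ hr hs hrr hz)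
      (fun r s s' hr hs hss z hz => hFam.ms _ _ _ hr hs hss hz)
      (by
        intro r s hr hs
        by_contra hne
        obtain ⟨z, hz⟩ := Set.nonempty_iff_ne_empty.2 hne
        refine hex ⟨r, s, hr, hs, fun _ => z, ?_⟩
        obtain ⟨V, hVs, hV, hzV⟩ := mem_interior.1 hz
        refine mem_interior.2 ⟨(fun v : Fin 1 → R => v 0) ⁻¹' V, ?_,
          hV.preimage (continuous_apply 0), hzV⟩
        intro v hv
        have h1 : (fun _ : Fin 1 => v 0) ∈ famFiber F r s := hVs hv
        rwa [hcoord] at h1)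
    intro x
    obtain ⟨U, hU, hxU, hfin⟩ := hL (x 0)
    refine ⟨(fun v : Fin 1 → R => v 0) ⁻¹' U, hU.preimage (continuous_apply 0), hxU, ?_⟩
    refine Set.Finite.of_injOn (f := fun v : Fin 1 → R => v 0) ?_ ?_ hfin
    · rintro v ⟨hv, hvU⟩
      rw [hXmem] at hv
      obtain ⟨s, hs, r, hr, h⟩ := hv
      refine ⟨⟨s, hs, r, hr, ?_⟩, hvU⟩
      change (fun _ : Fin 1 => v 0) ∈ famFiber F r s
      rwa [hcoord]
    · intro v _ w _ hvw
      rw [← hcoord v, ← hcoord w]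
      funext _
      exact hvw
end
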